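/- arXiv:0806.0482 — 4 statements merged into one kernel-verified Lean document; each statement's English description precedes it below -/
import Mathlib

section
/- Let d ≥ 1. Let α : ℤ^d → ℝ be finitely supported with Fourier transform α̂ vanishing nowhere on [0,2π)^d, let κ > 0, and let v : ℤ^d → ℝ be compactly supported with v(x) ≥ κ·1_{{0}}(x) for all x (i.e. v ≥ 0 and v(0) ≥ κ). Set u(x) := Σ_{k∈ℤ^d} α_k v(x−k). Let V_per : ℤ^d → ℝ be bounded and periodic with respect to a sublattice nℤ^d, and let (ω_k)_{k∈ℤ^d} be independent, identically distributed bounded real random variables whose distribution has a compactly supported density f of bounded variation. Set V_ω(x) := Σ_{k∈ℤ^d} ω_k u(x−k), H_ω := −Δ + V_per + V_ω on ℓ²(ℤ^d), and let H_ω^l be the compression of H_ω to ℓ²(Q_l) (simple boundary conditions). Then for every l ∈ ℕ and all real E₁ ≤ E₂ one has E{ Tr P_ω^l((E₁,E₂]) } ≤ κ^{−1} ‖f‖_BV ‖B‖₁ (2l+1)^d (E₂ − E₁), where P_ω^l((E₁,E₂]) is the spectral projection of the Hermitian matrix H_ω^l onto the interval (E₁,E₂] (so its trace is the number of eigenvalues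 of H_ω^l in (E₁,E₂], counted with multiplicity), and B is the inverse of the Laurent operator A of α on ℓ¹(ℤ^d) with ‖B‖₁ its ℓ¹-operator norm. -/
open MeasureTheory Matrix

noncomputable section

/-- The discrete cube `Q_s = {-s,…,s}^d ⊂ ℤ^d`, as a type. -/
abbrev DCube (d s : ℕ) := Fin d → (Set.Icc (-(s : ℤ)) (s : ℤ))

/-- Inclusion of the cube into `ℤ^d`. -/
def DCube.emb {d s : ℕ} (m : DCube d s) : Fin d → ℤ := fun i => (m i : ℤ)

/-- Matrix of the compression of the negative discrete Laplacian `-Δ` to `ℓ²(Q_l)`,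
where `(Δφ)(k) = ∑_i (φ(k+e_i) + φ(k-e_i))`. -/
def negLap (d l : ℕ) : Matrix (DCube d l) (DCube d l) ℂ := fun j k =>
  -(∑ i : Fin d,
      ((if k.emb = j.emb + Pi.single i 1 then (1 : ℂ) else 0) +
        (if k.emb = j.emb - Pi.single i 1 then (1 : ℂ) else 0)))

/-- Matrix of the compression of `-Δ + V` to `ℓ²(Q_l)`. -/
def schrodinger (d l : ℕ) (V : (Fin d → ℤ) → ℝ) : Matrix (DCube d l) (DCube d l) ℂ :=
  negLap d l + Matrix.diagonal fun j => (V j.emb : ℂ)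

/-- The spectral projection of a Hermitian matrix onto the set `I ⊆ ℝ`. -/
def specProj {n : Type*} [Fintype n] [DecidableEq n] {M : Matrix n n ℂ}
    (hM : M.IsHermitian) (I : Set ℝ) : Matrix n n ℂ :=
  (hM.eigenvectorUnitary : Matrix n n ℂ) *
    Matrix.diagonal (fun i => Set.indicator I (fun _ => (1 : ℂ)) (hM.eigenvalues i)) *
    star (hM.eigenvectorUnitary : Matrix n n ℂ)

/-- The Fourier transform `α̂(θ) = ∑_k α_k e^{-i⟨k,θ⟩}` of a (finitely supported)
sequence `α : ℤ^d → ℝ`. -/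
def fhat (d : ℕ) (α : (Fin d → ℤ) → ℝ) (θ : Fin d → ℝ) : ℂ :=
  ∑ᶠ k : Fin d → ℤ, (α k : ℂ) * Complex.exp (-Complex.I * ∑ i, (k i : ℂ) * (θ i : ℂ))


theorem lintegral_edist_translate_le_of_pos {f : ℝ → ℝ} (hf : Measurable f) {a : ℝ} (ha : 0 < a) :
    ∫⁻ x, edist (f (x + a)) (f x) ≤ ENNReal.ofReal a * eVariationOn f Set.univ := by
  have hm : Measurable fun x => edist (f (x + a)) (f x) :=
    (hf.comp (measurable_add_const a)).edist hf
  have hshift (n : ℤ) : ∫⁻ x in Set.Ioc (n • a) ((n + 1) • a), edist (f (x + a)) (f x) =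
      ∫⁻ x in Set.Ioc 0 a, edist (f (x + n • a + a)) (f (x + n • a)) := by
    have h := (measurePreserving_add_right volume (n • a)).setLIntegral_comp_preimage
      (measurableSet_Ioc (a := n • a) (b := (n + 1) • a)) hm
    rw [← h]
    congr 2
    rw [Set.preimage_add_const_Ioc, sub_self, add_smul, one_smul, add_sub_cancel_left]
  have hvar (x : ℝ) : ∑' n : ℤ, edist (f (x + n • a + a)) (f (x + n • a)) ≤
      eVariationOn f Set.univ := by
    rw [ENNReal.tsum_eq_iSup_sum]
    refine iSup_le fun S => ?_
    obtain ⟨N, hN⟩ : ∃ N : ℕ, ∀ n ∈ S, |n| < N := by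
      refine ⟨(∑ n ∈ S, n.natAbs) + 1, fun n hn => ?_⟩
      have := Finset.single_le_sum (f := fun n : ℤ => n.natAbs) (fun _ _ => Nat.zero_le _) hn
      rw [Int.abs_eq_natAbs]
      exact_mod_cast Nat.lt_succ_of_le this
    have hsub : S ⊆ (Finset.range (2 * N)).image fun i : ℕ => (i : ℤ) - N := by
      intro n hn
      have := abs_lt.1 (hN n hn)
      exact Finset.mem_image.2 ⟨(n + N).toNat, Finset.mem_range.2 (by omega), by omega⟩
    refine (Finset.sum_le_sum_of_subset hsub).trans ?_
    rw [Finset.sum_image fun i _ j _ h => by simpa using h]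
    have hmono : Monotone fun i : ℕ => x + ((i : ℤ) - N) • a := by
      intro i j hij
      have : (i : ℝ) ≤ j := by exact_mod_cast hij
      simp only [zsmul_eq_mul]
      push_cast
      nlinarith
    refine le_trans (le_of_eq ?_)
      (eVariationOn.sum_le (f := f) (n := 2 * N) hmono fun _ => Set.mem_univ _)
    refine Finset.sum_congr rfl fun i _ => ?_
    congr 2
    simp only [zsmul_eq_mul]
    push_cast
    ring
  calc ∫⁻ x, edist (f (x + a)) (f x)
      = ∑' n : ℤ, ∫⁻ x in Set.Ioc (n • a) ((n + 1) • a), edist (f (x + a)) (f x) := by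
        rw [← lintegral_iUnion (fun _ => measurableSet_Ioc) (Set.pairwise_disjoint_Ioc_zsmul a),
          iUnion_Ioc_zsmul ha, setLIntegral_univ]
    _ = ∫⁻ x in Set.Ioc 0 a, ∑' n : ℤ, edist (f (x + n • a + a)) (f (x + n • a)) := by
        simp_rw [hshift]
        exact (lintegral_tsum fun n => (hm.comp (measurable_add_const (n • a))).aemeasurable).symm
    _ ≤ ∫⁻ _ in Set.Ioc 0 a, eVariationOn f Set.univ := lintegral_mono fun x => hvar x
    _ = ENNReal.ofReal a * eVariationOn f Set.univ := by
        simp [mul_comm]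

theorem lintegral_edist_translate_le {f : ℝ → ℝ} (hf : Measurable f) (a : ℝ) :
    ∫⁻ x, edist (f (x + a)) (f x) ≤ ENNReal.ofReal |a| * eVariationOn f Set.univ := by
  rcases lt_trichotomy a 0 with ha | rfl | ha
  · rw [abs_of_neg ha]
    refine le_trans (le_of_eq ?_) (lintegral_edist_translate_le_of_pos hf (neg_pos.2 ha))
    rw [← lintegral_add_right_eq_self (fun x => edist (f (x + -a)) (f x)) a]
    simp [edist_comm]
  · simp
  · rw [abs_of_pos ha]
    exact lintegral_edist_translate_le_of_pos hf ha

/-- Translating by `a` a test function bounded by `C` changes its integral against the measure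
with density `f` by at most `C * |a|` times the total variation of `f`. -/
theorem lintegral_withDensity_translate_le {f : ℝ → ℝ} (hf : Measurable f)
    {φ : ℝ → ENNReal} (hφ : Measurable φ) {C : ENNReal} (hC : ∀ x, φ x ≤ C) (a : ℝ) :
    ∫⁻ x, φ (x + a) ∂(volume.withDensity fun x => ENNReal.ofReal (f x)) ≤
      ∫⁻ x, φ x ∂(volume.withDensity fun x => ENNReal.ofReal (f x)) +
        C * (ENNReal.ofReal |a| * eVariationOn f Set.univ) := by
  rw [lintegral_withDensity_eq_lintegral_mul _ hf.ennreal_ofReal hφ,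
    lintegral_withDensity_eq_lintegral_mul _ hf.ennreal_ofReal
      (show Measurable fun x => φ (x + a) from hφ.comp (measurable_add_const a)),
    ← lintegral_add_right_eq_self ((fun x => ENNReal.ofReal (f x)) * fun x => φ (x + a)) (-a)]
  have hm : Measurable fun x => edist (f (x + -a)) (f x) :=
    (hf.comp (measurable_add_const _)).edist hf
  calc ∫⁻ x, ((fun x => ENNReal.ofReal (f x)) * fun x => φ (x + a)) (x + -a)
      ≤ ∫⁻ x, (((fun x => ENNReal.ofReal (f x)) * φ) x + C * edist (f (x + -a)) (f x)) := by
        refine lintegral_mono fun x => ?_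
        simp only [Pi.mul_apply, neg_add_cancel_right]
        have h : ENNReal.ofReal (f (x + -a)) ≤
            ENNReal.ofReal (f x) + edist (f (x + -a)) (f x) := by
          rw [edist_dist, Real.dist_eq]
          refine le_trans (ENNReal.ofReal_le_ofReal ?_) ENNReal.ofReal_add_le
          linarith [le_abs_self (f (x + -a) - f x)]
        calc _ ≤ (ENNReal.ofReal (f x) + edist (f (x + -a)) (f x)) * φ x := by gcongr
          _ ≤ _ := by
            rw [add_mul, mul_comm (edist _ _)]
            gcongr
            exact hC x
    _ ≤ _ := by
        rw [lintegral_add_right _ (hm.const_mul C), lintegral_const_mul C hm]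
        gcongr
        simpa using lintegral_edist_translate_le hf (-a)

section Averaging

variable {K : Type*} [Fintype K] [DecidableEq K] {μ : Measure ℝ} [IsProbabilityMeasure μ]
  {b : ENNReal}

/-- Translating by `a` a test function bounded by `C` increases its `μ`-integral by at most
`C * |a| * b`. -/
def IsTranslationLipschitz (μ : Measure ℝ) (b : ENNReal) : Prop :=
  ∀ (φ : ℝ → ENNReal), Measurable φ → ∀ C : ENNReal, (∀ x, φ x ≤ C) → ∀ a : ℝ,
    ∫⁻ x, φ (x + a) ∂μ ≤ ∫⁻ x, φ x ∂μ + C * (ENNReal.ofReal |a| * b)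

theorem lintegral_pi_translate_single_le (hμ : IsTranslationLipschitz μ b)
    {F : (K → ℝ) → ENNReal} (hF : Measurable F) {C : ENNReal} (hC : ∀ x, F x ≤ C)
    (k : K) (a : ℝ) :
    ∫⁻ ω, F (ω + Pi.single k a) ∂(Measure.pi fun _ : K => μ) ≤
      ∫⁻ ω, F ω ∂(Measure.pi fun _ : K => μ) + C * (ENNReal.ofReal |a| * b) := by
  have hF' : Measurable fun ω : K → ℝ => F (ω + Pi.single k a) :=
    hF.comp (measurable_add_const _)
  have key (G : (K → ℝ) → ENNReal) (hG : Measurable G) :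
      ∫⁻ ω, G ω ∂(Measure.pi fun _ : K => μ) =
        (∫⋯∫⁻_(Finset.univ.erase k), (fun ω => ∫⁻ x, G (Function.update ω k x) ∂μ)
          ∂(fun _ : K => μ)) 0 := by
    rw [lintegral_eq_lmarginal_univ (0 : K → ℝ),
      lmarginal_erase' (μ := fun _ : K => μ) G hG (Finset.mem_univ k)]
  rw [key _ hF', key _ hF]
  have hupd (ω : K → ℝ) (x : ℝ) :
      Function.update ω k x + Pi.single k a = Function.update ω k (x + a) := by
    ext i
    by_cases h : i = k
    · subst h; simp
    · simp [h]
  calc _ ≤ (∫⋯∫⁻_(Finset.univ.erase k), (fun ω => ∫⁻ x, F (Function.update ω k x) ∂μ +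
          C * (ENNReal.ofReal |a| * b)) ∂(fun _ : K => μ)) 0 := by
        refine lmarginal_mono (fun ω => ?_) 0
        simp only [hupd]
        exact hμ (fun x => F (Function.update ω k x)) (hF.comp (measurable_update ω)) C
          (fun _ => hC _) a
    _ = _ := by
        simp only [lmarginal]
        rw [lintegral_add_right _ measurable_const, lintegral_const, measure_univ, mul_one]

theorem lintegral_pi_translate_le (hμ : IsTranslationLipschitz μ b)
    {F : (K → ℝ) → ENNReal} (hF : Measurable F) {C : ENNReal} (hC : ∀ x, F x ≤ C)
    (t : K → ℝ) :
    ∫⁻ ω, F (ω + t) ∂(Measure.pi fun _ : K => μ) ≤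
      ∫⁻ ω, F ω ∂(Measure.pi fun _ : K => μ) + C * ((∑ k, ENNReal.ofReal |t k|) * b) := by
  have h (S : Finset K) : ∫⁻ ω, F (ω + ∑ k ∈ S, Pi.single k (t k)) ∂(Measure.pi fun _ : K => μ) ≤
      ∫⁻ ω, F ω ∂(Measure.pi fun _ : K => μ) + C * ((∑ k ∈ S, ENNReal.ofReal |t k|) * b) := by
    induction S using Finset.induction_on with
    | empty => simp
    | insert k S hk ih =>
      rw [Finset.sum_insert hk, Finset.sum_insert hk, add_mul, mul_add, ← add_assoc,
        add_right_comm]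
      refine le_trans ?_ (add_le_add_left ih _)
      simp_rw [← add_assoc]
      exact lintegral_pi_translate_single_le hμ
        (F := fun ω => F (ω + ∑ k ∈ S, Pi.single k (t k)))
        (hF.comp (measurable_add_const _)) (fun _ => hC _) k (t k)
  simpa [Finset.univ_sum_single] using h Finset.univ

/-- If the integrals of `F` along all lines in direction `t` are bounded by `C`, then so is,
up to the translation constant of the measure, the expectation of `F`. -/
theorem lintegral_pi_le_of_line_integral_le (hμ : IsTranslationLipschitz μ b) (hb : b ≠ ⊤)
    {F : (K → ℝ) → ENNReal} (hF : Measurable F) {M : ENNReal} (hM : M ≠ ⊤) (hFM : ∀ x, F x ≤ M)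
    {C : ENNReal} (hC : C ≠ ⊤) (t : K → ℝ) (hline : ∀ ω, ∫⁻ s : ℝ, F (ω + s • t) ≤ C) :
    ∫⁻ ω, F ω ∂(Measure.pi fun _ : K => μ) ≤ C * ((∑ k, ENNReal.ofReal |t k|) * b) := by
  set P := Measure.pi fun _ : K => μ with hP
  set T := (∑ k, ENNReal.ofReal |t k|) * b with hT
  have hTtop : T ≠ ⊤ :=
    ENNReal.mul_ne_top (ENNReal.sum_ne_top.2 fun _ _ => ENNReal.ofReal_ne_top) hb
  have hFs : Measurable fun p : (K → ℝ) × ℝ => F (p.1 + p.2 • t) := by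
    refine hF.comp ?_
    fun_prop
  have hscale (a : ℝ) : (∑ k, ENNReal.ofReal |(a • t) k|) * b = ENNReal.ofReal |a| * T := by
    simp_rw [hT, Pi.smul_apply, smul_eq_mul, abs_mul, ENNReal.ofReal_mul (abs_nonneg a),
      ← Finset.mul_sum, mul_assoc]
  set Φ : (K → ℝ) → ENNReal := fun ω => ∫⁻ s in Set.Ioi (0 : ℝ), F (ω + s • t) with hΦ
  have hΦm : Measurable Φ := hFs.lintegral_prod_right'
  have hΦC (ω) : Φ ω ≤ C := (setLIntegral_le_lintegral _ _).trans (hline ω)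
  have hΦfin : ∫⁻ ω, Φ ω ∂P ≠ ⊤ := by
    refine ne_top_of_le_ne_top hC ((lintegral_mono hΦC).trans ?_)
    simp
  have main (ε : ℝ) (hε : 0 < ε) :
      ∫⁻ ω, F ω ∂P ≤ C * T + M * (ENNReal.ofReal ε * T) := by
    have h1 : ∫⁻ ω, Φ (ω + (-ε) • t) ∂P ≤ ∫⁻ ω, Φ ω ∂P + C * (ENNReal.ofReal ε * T) := by
      have := lintegral_pi_translate_le hμ hΦm hΦC ((-ε) • t)
      rwa [hscale, abs_neg, abs_of_pos hε] at this
    have h2 (ω) : Φ (ω + (-ε) • t) = Φ ω + ∫⁻ s in Set.Ioc (-ε) 0, F (ω + s • t) := by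
      have hsplit : Set.Ioi (-ε) = Set.Ioi 0 ∪ Set.Ioc (-ε) 0 := by
        rw [Set.union_comm, Set.Ioc_union_Ioi_eq_Ioi (by linarith)]
      have hdisj : Disjoint (Set.Ioi (0 : ℝ)) (Set.Ioc (-ε) 0) :=
        Set.disjoint_left.2 fun x hx hx' => not_lt.2 hx'.2 hx
      rw [hΦ]
      simp only
      rw [← lintegral_union measurableSet_Ioc hdisj, ← hsplit]
      have h := (measurePreserving_add_right volume (-ε)).setLIntegral_comp_preimage
        (measurableSet_Ioi (a := -ε)) (f := fun s => F (ω + s • t))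
        (hFs.comp measurable_prodMk_left)
      rw [← h, Set.preimage_add_const_Ioi, sub_self]
      simp_rw [add_smul]
      congr! 3
      abel
    have h3 : ∫⁻ ω, (∫⁻ s in Set.Ioc (-ε) 0, F (ω + s • t)) ∂P ≤ C * (ENNReal.ofReal ε * T) := by
      simp_rw [h2] at h1
      rw [lintegral_add_left hΦm] at h1
      exact (ENNReal.add_le_add_iff_left hΦfin).1 h1
    rw [lintegral_lintegral_swap hFs.aemeasurable] at h3
    have h4 : ∫⁻ s in Set.Ioc (-ε) 0, ∫⁻ ω, F ω ∂P ≤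
        ∫⁻ s in Set.Ioc (-ε) 0,
          (∫⁻ ω, F (ω + s • t) ∂P + M * (ENNReal.ofReal ε * T)) := by
      refine setLIntegral_mono' measurableSet_Ioc fun s hs => ?_
      have h := lintegral_pi_translate_le hμ (F := fun ω => F (ω + s • t))
        (hF.comp (measurable_add_const _)) (fun _ => hFM _) ((-s) • t)
      rw [hscale] at h
      simp only [neg_smul, neg_add_cancel_right] at h
      refine h.trans ?_
      gcongr
      rw [abs_neg, abs_of_nonpos hs.2]
      linarith [hs.1]
    rw [lintegral_add_right _ measurable_const] at h4
    simp only [lintegral_const, Measure.restrict_apply_univ, Real.volume_Ioc, sub_neg_eq_add,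
      zero_add] at h4
    have h5 : ENNReal.ofReal ε * ∫⁻ ω, F ω ∂P ≤
        ENNReal.ofReal ε * (C * T + M * (ENNReal.ofReal ε * T)) := by
      calc _ = (∫⁻ ω, F ω ∂P) * ENNReal.ofReal ε := mul_comm _ _
        _ ≤ _ := h4
        _ ≤ C * (ENNReal.ofReal ε * T) + M * (ENNReal.ofReal ε * T) * ENNReal.ofReal ε := by
          gcongr
        _ = _ := by ring
    exact (ENNReal.mul_le_mul_iff_right (by simpa using hε) ENNReal.ofReal_ne_top).1 h5
  refine ENNReal.le_of_forall_pos_le_add fun δ hδ _ => ?_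
  have hMT : M * T ≠ ⊤ := ENNReal.mul_ne_top hM hTtop
  set q := (M * T).toReal with hq
  have hq0 : 0 ≤ q := ENNReal.toReal_nonneg
  have hδ' : (0 : ℝ) < δ := hδ
  refine (main (δ / (q + 1)) (by positivity)).trans ?_
  gcongr
  calc M * (ENNReal.ofReal (δ / (q + 1)) * T) = ENNReal.ofReal (δ / (q + 1)) * (M * T) := by ring
    _ = ENNReal.ofReal (δ / (q + 1) * q) := by
      rw [ENNReal.ofReal_mul (by positivity), hq, ENNReal.ofReal_toReal hMT]
    _ ≤ ENNReal.ofReal δ := by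
      refine ENNReal.ofReal_le_ofReal ?_
      rw [div_mul_eq_mul_div, div_le_iff₀ (by positivity)]
      nlinarith
    _ = δ := ENNReal.ofReal_coe_nnreal

end Averaging


section Counting

variable {ι : Type*} [Fintype ι] [DecidableEq ι]

/-- The number of eigenvalues `≤ a` of a Hermitian matrix, counted with multiplicity. -/
def eigCount {A : Matrix ι ι ℂ} (hA : A.IsHermitian) (a : ℝ) : ℕ :=
  (Finset.univ.filter fun i => hA.eigenvalues i ≤ a).card

theorem eigCount_le_card {A : Matrix ι ι ℂ} (hA : A.IsHermitian) (a : ℝ) :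
    eigCount hA a ≤ Fintype.card ι := Finset.card_le_univ _

/-- The real part of the quadratic form of a matrix. -/
def quadForm (A : Matrix ι ι ℂ) (x : ι → ℂ) : ℝ := (star x ⬝ᵥ A *ᵥ x).re

omit [DecidableEq ι] in
theorem quadForm_add (A B : Matrix ι ι ℂ) (x : ι → ℂ) :
    quadForm (A + B) x = quadForm A x + quadForm B x := by
  simp [quadForm, add_mulVec, dotProduct_add]

theorem quadForm_diagonal (w : ι → ℝ) (x : ι → ℂ) :
    quadForm (diagonal fun i => (w i : ℂ)) x = ∑ i, w i * ‖x i‖ ^ 2 := by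
  simp only [quadForm, dotProduct, mulVec_diagonal, Pi.star_apply, Complex.re_sum]
  refine Finset.sum_congr rfl fun i _ => ?_
  rw [mul_left_comm, Complex.re_ofReal_mul]
  congr 1
  rw [RCLike.star_def, ← Complex.normSq_eq_conj_mul_self, Complex.ofReal_re,
    Complex.normSq_eq_norm_sq]

omit [DecidableEq ι] in
theorem quadForm_conj (A : Matrix ι ι ℂ) (T : Matrix ι ι ℂ) (x : ι → ℂ) :
    quadForm (Tᴴ * A * T) x = quadForm A (T *ᵥ x) := by
  simp only [quadForm, star_mulVec, ← mulVec_mulVec, dotProduct_mulVec, vecMul_vecMul]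

theorem quadForm_one (x : ι → ℂ) : quadForm 1 x = ∑ i, ‖x i‖ ^ 2 := by
  simpa using quadForm_diagonal (fun _ : ι => (1 : ℝ)) x

theorem Matrix.IsHermitian.quadForm_eq {A : Matrix ι ι ℂ} (hA : A.IsHermitian) (x : ι → ℂ) :
    quadForm A x = ∑ i, hA.eigenvalues i *
      ‖(star (hA.eigenvectorUnitary : Matrix ι ι ℂ) *ᵥ x) i‖ ^ 2 := by
  conv_lhs => rw [hA.spectral_theorem, Unitary.conjStarAlgAut_apply]
  rw [← quadForm_diagonal, ← quadForm_conj]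
  simp [star_eq_conjTranspose]
  rfl

theorem Matrix.IsHermitian.sum_norm_sq_eq {A : Matrix ι ι ℂ} (hA : A.IsHermitian) (x : ι → ℂ) :
    ∑ i, ‖x i‖ ^ 2 = ∑ i,
      ‖(star (hA.eigenvectorUnitary : Matrix ι ι ℂ) *ᵥ x) i‖ ^ 2 := by
  rw [← quadForm_one, ← quadForm_one, ← quadForm_conj]
  simp [star_eq_conjTranspose]
  simp [← star_eq_conjTranspose]

/-- Comparison of eigenvalue counts through a linear change of variables. -/
theorem eigCount_le_eigCount {A B : Matrix ι ι ℂ} (hA : A.IsHermitian) (hB : B.IsHermitian)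
    {a b : ℝ} (T : Matrix ι ι ℂ) (hT : Function.Injective T.mulVec)
    (h : ∀ x, quadForm A x ≤ a * ∑ i, ‖x i‖ ^ 2 →
      quadForm B (T *ᵥ x) ≤ b * ∑ i, ‖(T *ᵥ x) i‖ ^ 2) :
    eigCount hA a ≤ eigCount hB b := by
  classical
  set U := (hA.eigenvectorUnitary : Matrix ι ι ℂ) with hU
  set W := (hB.eigenvectorUnitary : Matrix ι ι ℂ) with hW
  have hUU : star U * U = 1 := Unitary.coe_star_mul_self _
  have hWW : W * star W = 1 := Unitary.coe_mul_star_self _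
  let extend : ({i // hA.eigenvalues i ≤ a} → ℂ) →ₗ[ℂ] (ι → ℂ) :=
    Function.ExtendByZero.linearMap ℂ Subtype.val
  let restr : (ι → ℂ) →ₗ[ℂ] ({i // hB.eigenvalues i ≤ b} → ℂ) :=
    LinearMap.funLeft ℂ ℂ Subtype.val
  let Ψ := restr ∘ₗ (star W * T * U).mulVecLin ∘ₗ extend
  have hinj : Function.Injective Ψ := by
    rw [injective_iff_map_eq_zero]
    intro c hc
    have hext (i) (hi : ¬ hA.eigenvalues i ≤ a) : extend c i = 0 := by
      simp only [extend, Function.ExtendByZero.linearMap_apply]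
      rw [Function.extend_apply' _ _ _ (by rintro ⟨j, rfl⟩; exact hi j.2)]
      rfl
    set x := U *ᵥ extend c with hx
    have hxU : star U *ᵥ x = extend c := by
      rw [hx, mulVec_mulVec, hUU, one_mulVec]
    have hA' : quadForm A x ≤ a * ∑ i, ‖x i‖ ^ 2 := by
      rw [hA.quadForm_eq, hA.sum_norm_sq_eq, ← hU, hxU, Finset.mul_sum]
      refine Finset.sum_le_sum fun i _ => ?_
      by_cases hi : hA.eigenvalues i ≤ a
      · gcongr
      · simp [hext i hi]
    have hy := h x hA'
    set y := T *ᵥ x with hyd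
    have hz (i) (hi : hB.eigenvalues i ≤ b) : (star W *ᵥ y) i = 0 := by
      have := congrFun hc ⟨i, hi⟩
      simp only [Ψ, restr, LinearMap.comp_apply, LinearMap.funLeft_apply, mulVecLin_apply,
        Pi.zero_apply] at this
      rw [hyd, hx, mulVec_mulVec, mulVec_mulVec]
      exact this
    rw [hB.quadForm_eq, hB.sum_norm_sq_eq, ← hW, Finset.mul_sum] at hy
    have hle (i) : b * ‖(star W *ᵥ y) i‖ ^ 2 ≤ hB.eigenvalues i * ‖(star W *ᵥ y) i‖ ^ 2 := by
      by_cases hi : hB.eigenvalues i ≤ b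
      · simp [hz i hi]
      · gcongr
        exact (not_le.1 hi).le
    have heq := (Finset.sum_eq_sum_iff_of_le fun i _ => hle i).1
      (le_antisymm (Finset.sum_le_sum fun i _ => hle i) hy)
    have hWy : star W *ᵥ y = 0 := by
      ext i
      by_cases hi : hB.eigenvalues i ≤ b
      · exact hz i hi
      · have h1 := heq i (Finset.mem_univ i)
        have h2 : ‖(star W *ᵥ y) i‖ ^ 2 = 0 := by
          have h3 := not_le.1 hi
          by_contra h4
          exact h3.ne (mul_right_cancel₀ h4 h1)
        simpa using h2
    have hy0 : y = 0 := by
      rw [← one_mulVec y, ← hWW, ← mulVec_mulVec, hWy, mulVec_zero]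
    have hx0 : x = 0 := hT (by rw [← hyd, hy0, mulVec_zero])
    have hc0 : extend c = 0 := by rw [← hxU, hx0, mulVec_zero]
    ext i
    have := congrFun hc0 i
    simpa [extend, Subtype.val_injective.extend_apply] using this
  have := LinearMap.finrank_le_finrank_of_injective hinj
  simpa [eigCount, Fintype.card_subtype] using this

omit [Fintype ι] in
theorem isHermitian_add_diagonal {M : Matrix ι ι ℂ} (hM : M.IsHermitian) (V : ι → ℝ) :
    (M + diagonal fun i => (V i : ℂ)).IsHermitian := by
  refine hM.add ?_
  rw [isHermitian_diagonal_iff]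
  intro i
  exact Complex.conj_ofReal _

/-- The number of eigenvalues `≤ a` of `M + V` for a diagonal matrix `V`. -/
def potCount {M : Matrix ι ι ℂ} (hM : M.IsHermitian) (a : ℝ) (V : ι → ℝ) : ℕ :=
  eigCount (isHermitian_add_diagonal hM V) a

variable {M : Matrix ι ι ℂ} (hM : M.IsHermitian) (a : ℝ)

theorem potCount_le_potCount {V V' : ι → ℝ} {a b : ℝ}
    (h : ∀ i, V' i - b ≤ V i - a) :
    potCount hM a V ≤ potCount hM b V' := by
  refine eigCount_le_eigCount _ _ 1
    (fun x y hxy => by simpa using hxy) fun x hx => ?_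
  rw [one_mulVec]
  rw [quadForm_add, quadForm_diagonal] at hx ⊢
  rw [Finset.mul_sum] at hx ⊢
  have : ∑ i, V' i * ‖x i‖ ^ 2 - ∑ i, b * ‖x i‖ ^ 2 ≤
      ∑ i, V i * ‖x i‖ ^ 2 - ∑ i, a * ‖x i‖ ^ 2 := by
    rw [← Finset.sum_sub_distrib, ← Finset.sum_sub_distrib]
    refine Finset.sum_le_sum fun i _ => ?_
    rw [← sub_mul, ← sub_mul]
    exact mul_le_mul_of_nonneg_right (h i) (by positivity)
  linarith

theorem potCount_shift (V : ι → ℝ) (h : ℝ) :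
    potCount hM a (V - fun _ => h) = potCount hM (a + h) V :=
  le_antisymm (potCount_le_potCount hM fun i => by simp; linarith)
    (potCount_le_potCount hM fun i => by simp; linarith)

theorem exists_gt_eigCount_eq {A : Matrix ι ι ℂ} (hA : A.IsHermitian) (a : ℝ) :
    ∃ b > a, eigCount hA b = eigCount hA a := by
  have h : ∀ᶠ b in nhdsWithin a (Set.Ioi a), ∀ i, a < hA.eigenvalues i → b < hA.eigenvalues i := by
    rw [Filter.eventually_all]
    intro i
    by_cases hi : a < hA.eigenvalues i
    · filter_upwards [mem_nhdsWithin_of_mem_nhds (Iio_mem_nhds hi)] with b hb _ using hb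
    · exact Filter.Eventually.of_forall fun b hb => absurd hb hi
  obtain ⟨b, hb, hab⟩ := (h.and self_mem_nhdsWithin).exists
  refine ⟨b, hab, ?_⟩
  unfold eigCount
  congr 1
  ext i
  simp only [Finset.mem_filter, Finset.mem_univ, true_and]
  refine ⟨fun hi => ?_, fun hi => hi.trans (le_of_lt hab)⟩
  by_contra hc
  exact absurd hi (not_le.2 (hb i (not_le.1 hc)))

theorem measurable_potCount : Measurable (potCount hM a) := by
  refine measurable_of_Iio fun k => IsOpen.measurableSet ?_
  rw [Metric.isOpen_iff]
  intro V hV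
  obtain ⟨b, hb, hbV⟩ := exists_gt_eigCount_eq (isHermitian_add_diagonal hM V) a
  refine ⟨b - a, sub_pos.2 hb, fun V' hV' => ?_⟩
  refine lt_of_le_of_lt (potCount_le_potCount hM (a := a) (b := b) (V' := V) fun i => ?_)
    (lt_of_eq_of_lt hbV hV)
  have h1 := (dist_le_pi_dist V' V i).trans_lt hV'
  rw [Real.dist_eq, abs_lt] at h1
  linarith [h1.1]

/-- Conjugation by `w ^ (-1/2)` turns adding multiples of a positive diagonal `w` into a shift of
the spectrum. -/
theorem potCount_add_smul_eq (V w : ι → ℝ) (hw : ∀ i, 0 < w i) :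
    ∃ (K : Matrix ι ι ℂ) (hK : K.IsHermitian),
      (∑ i, hK.eigenvalues i = ∑ i, ((M i i).re + V i - a) / w i) ∧
      ∀ s : ℝ, potCount hM a (V + s • w) = eigCount hK (-s) := by
  set D : Matrix ι ι ℂ := diagonal fun i => ((√(w i))⁻¹ : ℝ) with hD
  set D' : Matrix ι ι ℂ := diagonal fun i => ((√(w i)) : ℝ) with hD'
  set X : Matrix ι ι ℂ := M + diagonal fun i => ((V i - a : ℝ) : ℂ) with hX
  have hsq (i) : 0 < √(w i) := Real.sqrt_pos.2 (hw i)
  have hDD : D * D' = 1 := by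
    rw [hD, hD', diagonal_mul_diagonal, ← diagonal_one]
    congr 1
    ext i
    rw [← Complex.ofReal_mul, inv_mul_cancel₀ (hsq i).ne', Complex.ofReal_one]
  have hDD' : D' * D = 1 := mul_eq_one_comm.1 hDD
  have hXh : X.IsHermitian := isHermitian_add_diagonal hM fun i => V i - a
  have hK : (Dᴴ * X * D).IsHermitian := isHermitian_conjTranspose_mul_mul D hXh
  have inj {P Q : Matrix ι ι ℂ} (h : P * Q = 1) : Function.Injective Q.mulVec := by
    intro x y hxy
    have := congrArg P.mulVec hxy
    simpa [mulVec_mulVec, h] using this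
  have hform (s : ℝ) (x : ι → ℂ) :
      quadForm (M + diagonal fun i => (((V + s • w) i : ℝ) : ℂ)) (D *ᵥ x)
        - a * ∑ i, ‖(D *ᵥ x) i‖ ^ 2 = quadForm (Dᴴ * X * D) x + s * ∑ i, ‖x i‖ ^ 2 := by
    have h1 (i) : ‖(D *ᵥ x) i‖ ^ 2 * w i = ‖x i‖ ^ 2 := by
      rw [hD, mulVec_diagonal, norm_mul, Complex.norm_real, mul_pow, Real.norm_eq_abs, sq_abs,
        inv_pow, Real.sq_sqrt (hw i).le, mul_right_comm, inv_mul_cancel₀ (hw i).ne', one_mul]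
    simp_rw [← h1]
    rw [quadForm_conj, hX, quadForm_add, quadForm_add, quadForm_diagonal, quadForm_diagonal,
      Finset.mul_sum, Finset.mul_sum, add_sub_assoc, add_assoc, ← Finset.sum_sub_distrib,
      ← Finset.sum_add_distrib]
    congr 1
    refine Finset.sum_congr rfl fun i _ => ?_
    simp only [Pi.add_apply, Pi.smul_apply, smul_eq_mul]
    ring
  refine ⟨_, hK, ?_, fun s => le_antisymm ?_ ?_⟩
  · have h := congrArg Complex.re hK.trace_eq_sum_eigenvalues
    rw [Complex.re_sum] at h
    simp only [Complex.coe_algebraMap, Complex.ofReal_re] at h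
    refine (Eq.trans h.symm ?_)
    simp only [trace, Complex.re_sum, diag_apply]
    refine Finset.sum_congr rfl fun i _ => ?_
    rw [hD, diagonal_conjTranspose, mul_diagonal, diagonal_mul, hX]
    simp only [Pi.star_apply, RCLike.star_def, Complex.conj_ofReal, Matrix.add_apply,
      diagonal_apply_eq]
    rw [mul_right_comm, ← Complex.ofReal_mul, Complex.re_ofReal_mul, Complex.add_re,
      Complex.ofReal_re, ← mul_inv, Real.mul_self_sqrt (hw i).le]
    field_simp
    ring
  · refine eigCount_le_eigCount _ _ D' (inj hDD) fun x hx => ?_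
    have h := hform s (D' *ᵥ x)
    rw [mulVec_mulVec, hDD, one_mulVec] at h
    linarith
  · refine eigCount_le_eigCount _ _ D (inj hDD') fun x hx => ?_
    have h := hform s x
    linarith

theorem integral_indicator_Iic_sub (a b : ℝ) :
    Integrable (fun s : ℝ => (if s ≤ a then (1 : ℝ) else 0) - if s ≤ b then 1 else 0) ∧
    ∫ s : ℝ, ((if s ≤ a then (1 : ℝ) else 0) - if s ≤ b then 1 else 0) = a - b := by
  have h : (fun s : ℝ => (if s ≤ a then (1 : ℝ) else 0) - if s ≤ b then 1 else 0) =
      fun s => (Set.Ioc b a).indicator (fun _ => (1 : ℝ)) s -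
        (Set.Ioc a b).indicator (fun _ => (1 : ℝ)) s := by
    ext s
    simp only [Set.indicator_apply, Set.mem_Ioc]
    grind
  have hi (p q : ℝ) : Integrable ((Set.Ioc p q).indicator fun _ => (1 : ℝ)) :=
    (integrable_indicator_iff measurableSet_Ioc).2 (integrableOn_const (by simp))
  rw [h]
  refine ⟨(hi _ _).sub (hi _ _), ?_⟩
  rw [integral_sub (hi _ _) (hi _ _), integral_indicator measurableSet_Ioc,
    integral_indicator measurableSet_Ioc]
  simp only [integral_const, MeasurableSet.univ, measureReal_restrict_apply, Set.univ_inter,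
    Real.volume_real_Ioc, smul_eq_mul, mul_one]
  grind

/-- Spectral averaging: along a line in a positive potential direction `w`, lowering the
potential at the site `j` by `h` creates on average at most `h / w j` eigenvalues below `a`. -/
theorem lintegral_potCount_sub_le (V w : ι → ℝ) (hw : ∀ i, 0 < w i) (j : ι) {h : ℝ}
    (hh : 0 ≤ h) :
    ∫⁻ s : ℝ, ((potCount hM a (V + s • w - Pi.single j h) - potCount hM a (V + s • w) : ℕ) :
      ENNReal) ≤ ENNReal.ofReal (h / w j) := by
  obtain ⟨K, hK, hKt, hKc⟩ := potCount_add_smul_eq hM a V w hw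
  obtain ⟨K', hK', hKt', hKc'⟩ := potCount_add_smul_eq hM a (V - Pi.single j h) w hw
  have hcount {A : Matrix ι ι ℂ} (hA : A.IsHermitian) (s : ℝ) :
      (eigCount hA (-s) : ℝ) = ∑ i, if s ≤ -hA.eigenvalues i then (1 : ℝ) else 0 := by
    simp only [eigCount, Finset.sum_boole, le_neg]
  have hmono (s : ℝ) : eigCount hK (-s) ≤ eigCount hK' (-s) := by
    rw [← hKc, ← hKc']
    refine potCount_le_potCount hM fun i => ?_
    have : 0 ≤ (Pi.single j h : ι → ℝ) i := by
      by_cases hi : i = j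
      · subst hi; simpa
      · simp [hi]
    simp only [Pi.add_apply, Pi.sub_apply]
    linarith
  have hint := fun i : ι => integral_indicator_Iic_sub (-hK'.eigenvalues i) (-hK.eigenvalues i)
  have hfun (s : ℝ) :
      ((potCount hM a (V + s • w - Pi.single j h) - potCount hM a (V + s • w) : ℕ) : ENNReal) =
      ENNReal.ofReal (∑ i, ((if s ≤ -hK'.eigenvalues i then (1 : ℝ) else 0) -
        if s ≤ -hK.eigenvalues i then 1 else 0)) := by
    rw [add_sub_right_comm, hKc, hKc', Finset.sum_sub_distrib, ← hcount, ← hcount,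
      ← Nat.cast_sub (hmono s), ENNReal.ofReal_natCast]
  simp_rw [hfun]
  rw [← ofReal_integral_eq_lintegral_ofReal (integrable_finsetSum _ fun i _ => (hint i).1),
    integral_finsetSum _ fun i _ => (hint i).1]
  · refine ENNReal.ofReal_le_ofReal (le_of_eq ?_)
    simp_rw [fun i => (hint i).2, neg_sub_neg]
    rw [Finset.sum_sub_distrib, hKt, hKt', ← Finset.sum_sub_distrib,
      Finset.sum_eq_single j]
    · simp
      ring
    · intro i _ hi
      simp [hi]
    · simp
  · refine Filter.Eventually.of_forall fun s => ?_
    simp only [Pi.zero_apply]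
    rw [Finset.sum_sub_distrib, ← hcount, ← hcount, sub_nonneg]
    exact_mod_cast hmono s

end Counting

section Convolution

variable {G : Type*} [AddCommGroup G] [DecidableEq G]

/-- If `β` is a convolution inverse of `α`, then convolving `α * v` with `β` gives back `v`. -/
theorem finsum_mul_convolution_eq {α β u v : G → ℝ} (hα : (Function.support α).Finite)
    (hv : (Function.support v).Finite) (hu : ∀ x, u x = ∑ᶠ k, α k * v (x - k))
    (hβ : ∀ m, (∑ᶠ k, α k * β (m - k)) = if m = 0 then 1 else 0) (x j : G) :
    ∑ᶠ k, β (k - j) * u (x - k) = v (x - j) := by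
  have hsub (g : G → ℝ) (m : G) : ∑ᶠ k, α k * g (m - k) =
      ∑ k ∈ hα.toFinset, α k * g (m - k) :=
    finsum_eq_sum_of_support_subset _ fun k hk => by
      simpa using left_ne_zero_of_mul hk
  have hfin (y : G) (c : G → ℝ) : (Function.support fun k => c k * v (y - k)).Finite := by
    refine (hv.preimage (f := fun k => y - k) (sub_right_injective.injOn)).subset fun k hk => ?_
    exact right_ne_zero_of_mul hk
  calc ∑ᶠ k, β (k - j) * u (x - k)
      = ∑ᶠ k, ∑ m ∈ hα.toFinset, (α m * β (k - j)) * v (x - m - k) := by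
        refine finsum_congr fun k => ?_
        rw [hu, hsub, Finset.mul_sum]
        refine Finset.sum_congr rfl fun m _ => ?_
        rw [sub_right_comm x k m]
        ring
    _ = ∑ m ∈ hα.toFinset, ∑ᶠ k, (α m * β (k - j)) * v (x - m - k) :=
        finsum_sum_comm _ _ fun m _ => hfin (x - m) fun k => α m * β (k - j)
    _ = ∑ m ∈ hα.toFinset, ∑ᶠ p, (α m * β (p - j - m)) * v (x - p) := by
        refine Finset.sum_congr rfl fun m _ => ?_
        refine finsum_eq_of_bijective (fun k => k + m) (Equiv.addRight m).bijective fun k => ?_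
        congr 2
        · congr 1; abel_nf
        · abel_nf
    _ = ∑ᶠ p, ∑ m ∈ hα.toFinset, (α m * β (p - j - m)) * v (x - p) :=
        (finsum_sum_comm _ _ fun m _ => hfin x fun p => α m * β (p - j - m)).symm
    _ = ∑ᶠ p, (if p - j = 0 then 1 else 0) * v (x - p) := by
        refine finsum_congr fun p => ?_
        rw [← Finset.sum_mul, ← hsub, hβ]
    _ = v (x - j) := by
        rw [finsum_eq_single _ j]
        · simp
        · intro p hp
          rw [if_neg (sub_ne_zero.2 hp), zero_mul]

end Convolution

section Wegner

variable {ι K : Type*} [Fintype ι] [DecidableEq ι] [Fintype K] [DecidableEq K]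
  {M : Matrix ι ι ℂ} (hM : M.IsHermitian) (a : ℝ)
  {μ : Measure ℝ} [IsProbabilityMeasure μ] {b : ENNReal}

omit [Fintype K] [DecidableEq K] in
theorem measurable_potCount_sub {L L' : (K → ℝ) → ι → ℝ} (hL : Measurable L)
    (hL' : Measurable L') :
    Measurable fun ω => ((potCount hM a (L' ω) - potCount hM a (L ω) : ℕ) : ENNReal) :=
  (Measurable.of_discrete (f := fun n : ℕ => (n : ENNReal))).comp
    (((measurable_potCount hM a).comp hL').sub ((measurable_potCount hM a).comp hL))

theorem lintegral_potCount_site_le (hμ : IsTranslationLipschitz μ b) (hb : b ≠ ⊤)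
    {L : (K → ℝ) → ι → ℝ} (hL : Measurable L) {t : K → ℝ} {w : ι → ℝ}
    (hLt : ∀ ω (s : ℝ), L (ω + s • t) = L ω + s • w) (hw : ∀ i, 0 < w i)
    {κ : ℝ} (hκ : 0 < κ) {j : ι} (hj : κ ≤ w j) {h : ℝ} (hh : 0 ≤ h) :
    ∫⁻ ω, ((potCount hM a (L ω - Pi.single j h) - potCount hM a (L ω) : ℕ) : ENNReal)
        ∂(Measure.pi fun _ : K => μ) ≤
      ENNReal.ofReal (h / κ) * ((∑ k, ENNReal.ofReal |t k|) * b) := by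
  refine lintegral_pi_le_of_line_integral_le hμ hb
    (measurable_potCount_sub hM a hL (hL.sub_const _))
    (M := Fintype.card ι) (ENNReal.natCast_ne_top _) (fun ω => ?_) ENNReal.ofReal_ne_top t
    fun ω => ?_
  · exact_mod_cast (Nat.sub_le _ _).trans (eigCount_le_card _ _)
  · simp_rw [hLt]
    refine (lintegral_potCount_sub_le hM a (L ω) w hw j hh).trans (ENNReal.ofReal_le_ofReal ?_)
    gcongr

omit [Fintype K] [DecidableEq K] in
theorem lintegral_potCount_shift_le {c h : ℝ} {L : (K → ℝ) → ι → ℝ} (hL : Measurable L)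
    {P : Measure (K → ℝ)}
    (hsite : ∀ (V : ι → ℝ) (j : ι), ∫⁻ ω, ((potCount hM a (L ω - V - Pi.single j h) -
      potCount hM a (L ω - V) : ℕ) : ENNReal) ∂P ≤ ENNReal.ofReal c) :
    ∫⁻ ω, ((potCount hM a (L ω - fun _ => h) - potCount hM a (L ω) : ℕ) : ENNReal) ∂P ≤
      Fintype.card ι * ENNReal.ofReal c := by
  have key (S : Finset ι) : ∫⁻ ω, ((potCount hM a (L ω - ∑ i ∈ S, Pi.single i h) -
      potCount hM a (L ω) : ℕ) : ENNReal) ∂P ≤ S.card * ENNReal.ofReal c := by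
    induction S using Finset.induction_on with
    | empty => simp
    | insert j S hj ih =>
      rw [Finset.sum_insert hj, Finset.card_insert_of_notMem hj, Nat.cast_add, Nat.cast_one,
        add_mul, one_mul]
      refine le_trans ?_ (add_le_add ih (hsite (∑ i ∈ S, Pi.single i h) j))
      rw [← lintegral_add_left (measurable_potCount_sub hM a hL (hL.sub_const _))]
      refine lintegral_mono fun ω => ?_
      rw [sub_add_eq_sub_sub_swap]
      rw [← Nat.cast_add]
      exact Nat.cast_le.2 (by omega)
  have hs : (∑ i : ι, Pi.single i h : ι → ℝ) = fun _ => h :=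
    Finset.univ_sum_single fun _ : ι => h
  simpa [hs] using key Finset.univ

theorem trace_specProj_re {A : Matrix ι ι ℂ} (hA : A.IsHermitian) {E₁ E₂ : ℝ} (hE : E₁ ≤ E₂) :
    (trace (specProj hA (Set.Ioc E₁ E₂))).re = ((eigCount hA E₂ - eigCount hA E₁ : ℕ) : ℝ) := by
  classical
  have hU : star (hA.eigenvectorUnitary : Matrix ι ι ℂ) * hA.eigenvectorUnitary = 1 :=
    Unitary.coe_star_mul_self _
  rw [specProj, trace_mul_cycle, hU, one_mul, trace_diagonal, Complex.re_sum]
  have hsub : (Finset.univ.filter fun i => hA.eigenvalues i ≤ E₁) ⊆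
      Finset.univ.filter fun i => hA.eigenvalues i ≤ E₂ :=
    Finset.monotone_filter_right _ fun i _ hi => le_trans hi hE
  rw [eigCount, eigCount, ← Finset.card_sdiff_of_subset hsub, Finset.card_eq_sum_ones,
    Nat.cast_sum, ← Finset.sum_subset (Finset.subset_univ _)]
  · refine Finset.sum_congr rfl fun i hi => ?_
    have : hA.eigenvalues i ∈ Set.Ioc E₁ E₂ := by simpa [and_comm] using hi
    simp [Set.indicator_of_mem this]
  · intro i _ hi
    have : hA.eigenvalues i ∉ Set.Ioc E₁ E₂ := by
      intro h
      exact hi (by simpa [and_comm] using h)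
    simp [Set.indicator_of_notMem this]

end Wegner

theorem DCube.emb_injective {d s : ℕ} : Function.Injective (DCube.emb (d := d) (s := s)) :=
  fun _ _ h => funext fun i => Subtype.ext (congrFun h i)

theorem DCube.mem_range_emb {d s : ℕ} {x : Fin d → ℤ} (h : ∀ i, |x i| ≤ (s : ℤ)) :
    x ∈ Set.range (DCube.emb (d := d) (s := s)) :=
  ⟨fun i => ⟨x i, abs_le.1 (h i)⟩, rfl⟩

theorem DCube.abs_emb_le {d s : ℕ} (m : DCube d s) (i : Fin d) : |m.emb i| ≤ (s : ℤ) :=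
  abs_le.2 (m i).2

theorem DCube.card {d s : ℕ} : Fintype.card (DCube d s) = (2 * s + 1) ^ d := by
  rw [Fintype.card_fun, Fintype.card_fin, Fintype.card_ofFinset, Int.card_Icc]
  congr 1
  omega

/-- **Wegner estimate for the discrete Anderson model with a sign-changing single site
potential of generalised step function form** (Theorem 1 of the paper, discrete case):
`E{ Tr P_ω^l((E₁,E₂]) } ≤ κ⁻¹ ‖f‖_BV ‖B‖₁ (2l+1)^d (E₂-E₁)`.

Here the coupling constants `(ω_k)_{k ∈ Q_{l+R}}` (those are all that influence `H_ω^l`,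
since `supp u ⊆ Λ_R`) are i.i.d. with common distribution of density `f`, i.e. the
expectation is the integral with respect to the product of the measures `f dx`;
`‖f‖_BV` is the total variation of `f`, and `‖B‖₁ = ∑_n |β_n|` is the `ℓ¹`-operator norm
of the inverse `B` of the Laurent operator `A` of `α`, represented by its convolution
kernel `β` (the convolution inverse of `α`). -/
theorem wegner_estimate_anderson
    (d : ℕ) (hd : 1 ≤ d) (l : ℕ)
    -- the single site potential of generalised step function form
    (α : (Fin d → ℤ) → ℝ) (hαfin : (Function.support α).Finite)
    (hαhat : ∀ θ : Fin d → ℝ, (∀ i, θ i ∈ Set.Ico (0 : ℝ) (2 * Real.pi)) → fhat d α θ ≠ 0)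
    (κ : ℝ) (hκ : 0 < κ)
    (v : (Fin d → ℤ) → ℝ) (hv : ∀ x, v x ≥ if x = 0 then κ else 0)
    (hvfin : (Function.support v).Finite)
    (u : (Fin d → ℤ) → ℝ) (hu : ∀ x, u x = ∑ᶠ k : Fin d → ℤ, α k * v (x - k))
    (R : ℕ) (hR : ∀ x : Fin d → ℤ, u x ≠ 0 → ∀ i, |x i| ≤ (R : ℤ))
    -- the periodic background potential
    (Vper : (Fin d → ℤ) → ℝ) (n : ℕ) (hn : 1 ≤ n)
    (hVper : ∀ x k : Fin d → ℤ, Vper (x + fun i => (n : ℤ) * k i) = Vper x)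
    (hVbdd : ∃ C, ∀ x, |Vper x| ≤ C)
    -- the density of the i.i.d. coupling constants: compactly supported, of bounded variation
    (f : ℝ → ℝ) (hf0 : ∀ x, 0 ≤ f x) (hfm : Measurable f) (hfc : HasCompactSupport f)
    (hf1 : ∫ x, f x = 1) (hfBV : eVariationOn f Set.univ ≠ ⊤)
    -- the convolution kernel β of the inverse B of the Laurent operator A of α
    (β : (Fin d → ℤ) → ℝ) (hβ : Summable fun m => |β m|)
    (hβconv : ∀ m : Fin d → ℤ,
      (∑ᶠ k : Fin d → ℤ, α k * β (m - k)) = if m = 0 then 1 else 0)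
    -- the random Hamiltonian restricted to the cube `Q_l` is Hermitian
    (hherm : ∀ V : (Fin d → ℤ) → ℝ, (schrodinger d l V).IsHermitian)
    (E₁ E₂ : ℝ) (hE : E₁ ≤ E₂) :
    ∫ ω : DCube d (l + R) → ℝ,
        (Matrix.trace (specProj
          (hherm fun x => Vper x + ∑ k : DCube d (l + R), ω k * u (x - k.emb))
          (Set.Ioc E₁ E₂))).re
        ∂(Measure.pi fun _ : DCube d (l + R) =>
            volume.withDensity fun x => ENNReal.ofReal (f x)) ≤
      κ⁻¹ * (eVariationOn f Set.univ).toReal * (∑' m, |β m|) *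
        (2 * l + 1) ^ d * (E₂ - E₁) := by
  set μ : Measure ℝ := volume.withDensity fun x => ENNReal.ofReal (f x) with hμdef
  set B : ℝ := ∑' m, |β m| with hB
  set b := eVariationOn f Set.univ with hb
  set h := E₂ - E₁ with hh
  have hh0 : 0 ≤ h := sub_nonneg.2 hE
  have hB0 : 0 ≤ B := tsum_nonneg fun _ => abs_nonneg _
  have hfint : Integrable f := by
    by_contra hc
    rw [integral_undef hc] at hf1
    exact zero_ne_one hf1
  have : IsProbabilityMeasure μ := ⟨by
    rw [hμdef, withDensity_apply _ MeasurableSet.univ, setLIntegral_univ,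
      ← ofReal_integral_eq_lintegral_ofReal hfint (Filter.Eventually.of_forall hf0), hf1,
      ENNReal.ofReal_one]⟩
  have hμ : IsTranslationLipschitz μ b := fun φ hφ C hC a =>
    lintegral_withDensity_translate_le hfm hφ hC a
  set P := Measure.pi fun _ : DCube d (l + R) => μ with hP
  have hv0 (x) : 0 ≤ v x := le_trans (by split_ifs <;> linarith) (hv x)
  have hvκ : κ ≤ v 0 := by simpa using hv 0
  have hconv (x j : DCube d l) :
      ∑ k : DCube d (l + R), β (k.emb - j.emb) * u (x.emb - k.emb) = v (x.emb - j.emb) := by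
    rw [← finsum_mul_convolution_eq hαfin hvfin hu hβconv x.emb j.emb,
      finsum_eq_finsetSum_of_support_subset (s := Finset.univ.image (DCube.emb (s := l + R))),
      Finset.sum_image DCube.emb_injective.injOn]
    intro k hk
    rw [Finset.coe_image, Finset.coe_univ, Set.image_univ]
    refine DCube.mem_range_emb fun i => ?_
    have h1 := abs_le.1 (hR _ (right_ne_zero_of_mul hk) i)
    have h2 := abs_le.1 (x.abs_emb_le i)
    rw [Pi.sub_apply] at h1
    rw [abs_le]
    push_cast
    constructor <;> linarith [h1.1, h1.2, h2.1, h2.2]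
  have hβsum (j : DCube d l) : ∑ k : DCube d (l + R), |β (k.emb - j.emb)| ≤ B := by
    have hinj : Function.Injective fun k : DCube d (l + R) => k.emb - j.emb :=
      fun _ _ h => DCube.emb_injective (sub_left_injective h)
    rw [← tsum_fintype (L := .unconditional _)]
    exact Summable.tsum_le_tsum_of_inj _ hinj (fun _ _ => abs_nonneg _) (fun _ => le_rfl)
      (Summable.of_finite) hβ
  have hM : (negLap d l).IsHermitian := by
    have := hherm fun _ => 0
    simpa [schrodinger] using this
  set L : (DCube d (l + R) → ℝ) → DCube d l → ℝ :=
    fun ω x => Vper x.emb + ∑ k : DCube d (l + R), ω k * u (x.emb - k.emb) with hL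
  have hLm : Measurable L := by
    refine measurable_pi_lambda _ fun x => ?_
    fun_prop
  set N : ℝ := (Fintype.card (DCube d l) : ℝ) with hN
  have hsite (V : DCube d l → ℝ) (j : DCube d l) :
      ∫⁻ ω, ((potCount hM E₁ (L ω - V - Pi.single j h) - potCount hM E₁ (L ω - V) : ℕ) :
        ENNReal) ∂P ≤ ENNReal.ofReal (h / κ * (B * b.toReal)) := by
    have hδ (δ : ℝ) (hδ : 0 < δ) :
        ∫⁻ ω, ((potCount hM E₁ (L ω - V - Pi.single j h) - potCount hM E₁ (L ω - V) : ℕ) :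
          ENNReal) ∂P ≤ ENNReal.ofReal (h / κ * ((B + δ * (N * B)) * b.toReal)) := by
      set t : DCube d (l + R) → ℝ := fun k =>
        β (k.emb - j.emb) + δ * ∑ i : DCube d l, β (k.emb - i.emb) with ht
      set w : DCube d l → ℝ := fun x =>
        v (x.emb - j.emb) + δ * ∑ i : DCube d l, v (x.emb - i.emb) with hw
      have htw (x : DCube d l) : ∑ k, t k * u (x.emb - k.emb) = w x := by
        simp only [ht, hw, add_mul, Finset.sum_add_distrib, hconv, mul_assoc, Finset.sum_mul,
          ← Finset.mul_sum]
        rw [Finset.sum_comm]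
        simp only [hconv]
      have hsum (x : DCube d l) : κ ≤ ∑ i : DCube d l, v (x.emb - i.emb) := by
        refine le_trans ?_ (Finset.single_le_sum (f := fun i : DCube d l => v (x.emb - i.emb))
          (fun _ _ => hv0 _) (Finset.mem_univ x))
        simpa using hvκ
      have hwpos (x : DCube d l) : 0 < w x :=
        add_pos_of_nonneg_of_pos (hv0 _) (mul_pos hδ (hκ.trans_le (hsum x)))
      have hwj : κ ≤ w j := by
        have := mul_pos hδ (hκ.trans_le (hsum j))
        simp only [hw, sub_self]
        linarith
      have htsum : ∑ k, |t k| ≤ B + δ * (N * B) := by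
        calc ∑ k, |t k| ≤ ∑ k : DCube d (l + R), (|β (k.emb - j.emb)| +
              δ * ∑ i : DCube d l, |β (k.emb - i.emb)|) := by
              refine Finset.sum_le_sum fun k _ => (abs_add_le _ _).trans ?_
              rw [abs_mul, abs_of_pos hδ]
              gcongr
              exact Finset.abs_sum_le_sum_abs _ _
          _ = ∑ k : DCube d (l + R), |β (k.emb - j.emb)| +
              δ * ∑ i : DCube d l, ∑ k : DCube d (l + R), |β (k.emb - i.emb)| := by
              rw [Finset.sum_add_distrib, ← Finset.mul_sum, Finset.sum_comm]
          _ ≤ B + δ * ∑ i : DCube d l, B := by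
              gcongr with i
              · exact hβsum j
              · exact hβsum i
          _ = B + δ * (N * B) := by simp [hN]
      have hLt (ω) (s : ℝ) : L (ω + s • t) - V = L ω - V + s • w := by
        ext x
        simp only [hL, Pi.sub_apply, Pi.add_apply, Pi.smul_apply, smul_eq_mul, ← htw, add_mul,
          Finset.sum_add_distrib, Finset.mul_sum, mul_assoc]
        ring
      refine (lintegral_potCount_site_le hM E₁ hμ hfBV (L := fun ω => L ω - V)
        (hLm.sub_const V) hLt hwpos hκ hwj hh0).trans ?_
      rw [← ENNReal.ofReal_sum_of_nonneg fun _ _ => abs_nonneg _,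
        ENNReal.ofReal_mul (by positivity), ENNReal.ofReal_mul (by positivity),
        ENNReal.ofReal_toReal hfBV]
      gcongr
    have hcont : Continuous fun δ : ℝ =>
        ENNReal.ofReal (h / κ * ((B + δ * (N * B)) * b.toReal)) :=
      ENNReal.continuous_ofReal.comp (by fun_prop)
    have hlim := (hcont.tendsto 0).mono_left (nhdsWithin_le_nhds (s := Set.Ioi 0))
    rw [zero_mul, add_zero] at hlim
    exact ge_of_tendsto hlim (by filter_upwards [self_mem_nhdsWithin] with δ h using hδ δ h)
  have htot := lintegral_potCount_shift_le hM E₁ hLm hsite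
  have hint (ω : DCube d (l + R) → ℝ) :
      (Matrix.trace (specProj
        (hherm fun x => Vper x + ∑ k : DCube d (l + R), ω k * u (x - k.emb))
        (Set.Ioc E₁ E₂))).re =
      ((potCount hM E₁ (L ω - fun _ => h) - potCount hM E₁ (L ω) : ℕ) : ℝ) := by
    rw [trace_specProj_re _ hE, potCount_shift, hh, add_sub_cancel]
    rfl
  simp_rw [hint]
  have hmeas := measurable_potCount_sub hM E₁ hLm (hLm.sub_const fun _ => h)
  rw [integral_eq_lintegral_of_nonneg_ae (Filter.Eventually.of_forall fun _ => Nat.cast_nonneg _)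
    (by simpa only [ENNReal.toReal_natCast] using hmeas.ennreal_toReal.aestronglyMeasurable)]
  simp_rw [ENNReal.ofReal_natCast]
  have hκ' : 0 ≤ h / κ * (B * b.toReal) := by positivity
  refine (ENNReal.toReal_mono (by finiteness) htot).trans (le_of_eq ?_)
  rw [ENNReal.toReal_mul, ENNReal.toReal_natCast, ENNReal.toReal_ofReal hκ', DCube.card]
  push_cast
  ring

end
end

section
/- Let d ≥ 1, let α : ℤ^d → ℝ be finitely supported with supp α ⊂ Λ_D and with Fourier transform α̂ vanishing nowhere on [0,2π)^d. Let r ∈ ℕ, set R := r + D, and let l ∈ ℕ with l > R. Let Γ := (2(l+R)+1)ℤ^d and let π : ℤ^d → Q_{l+R} be the map sending m to the unique element of Q_{l+R} ∩ (m + Γ). Define the matrix A_Λ indexed by Q_{l+R} × Q_{l+R} by A_Λ(j,k) := α_{π(j−k)}. Then: (i) A_Λ(j,k) = α_{j−k} for all j ∈ Q_{l+r} and k ∈ Q_{l+R}; (ii) A_Λ is invertible; and (iii) its inverse B_Λ satisfies ‖B_Λ‖₁ ≤ ‖B‖₁ < ∞, where B is the inverse of the Laurent operator A of α on ℓ¹(ℤ^d)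 and ‖B‖₁ its ℓ¹-operator norm. -/
open Matrix

noncomputable section

/-- Integers in `[-M, M]` that are congruent modulo `2 * M + 1` are equal. -/
theorem int_eq_of_dvd_sub_of_abs_le {M : ℤ} {x y : ℤ} (hx : |x| ≤ M) (hy : |y| ≤ M)
    (h : (2 * M + 1) ∣ x - y) : x = y := by
  have h0 := Int.eq_zero_of_abs_lt_dvd h (by grind)
  omega

theorem abs_tsum_ite_le {ι : Type*} {β : ι → ℝ} (hβ : Summable fun n => |β n|)
    (p : ι → Prop) [DecidablePred p] :
    |∑' n, if p n then β n else 0| ≤ ∑' n, if p n then |β n| else 0 := by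
  have hs : Summable fun n => ‖if p n then β n else 0‖ :=
    hβ.of_nonneg_of_le (fun n => norm_nonneg _) fun n => by
      by_cases h : p n <;> simp [h]
  refine (norm_tsum_le_tsum_norm hs).trans_eq (tsum_congr fun n => ?_)
  by_cases h : p n <;> simp [h]

theorem summable_ite_of_summable_abs {ι : Type*} {β : ι → ℝ} (hβ : Summable fun n => |β n|)
    (p : ι → Prop) [DecidablePred p] : Summable fun n => if p n then β n else 0 := by
  refine Summable.of_norm_bounded hβ fun n => ?_
  by_cases h : p n <;> simp [h]

/-- Summing the absolute values of the partial sums of `β` over the fibres of a map to a finite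
type gives at most the `ℓ¹` norm of `β`. -/
theorem sum_abs_tsum_fiber_le {ι κ : Type*} [Fintype κ] [DecidableEq κ] {β : ι → ℝ}
    (hβ : Summable fun n => |β n|) (f : ι → κ) :
    ∑ j, |∑' n, if j = f n then β n else 0| ≤ ∑' n, |β n| := by
  have hβ' : Summable fun n => |(|β n|)| := by simpa using hβ
  calc ∑ j, |∑' n, if j = f n then β n else 0|
      ≤ ∑ j, ∑' n, if j = f n then |β n| else 0 :=
        Finset.sum_le_sum fun j _ => abs_tsum_ite_le hβ _
    _ = ∑' n, ∑ j, if j = f n then |β n| else 0 :=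
        (Summable.tsum_finsetSum fun j _ => summable_ite_of_summable_abs hβ' _).symm
    _ = ∑' n, |β n| := by simp

/-- If `β` is a summable convolution inverse of `α`, where `supp α` is contained in the fundamental
cube, then periodizing `β` yields a right inverse of the periodized convolution matrix of `α`. -/
theorem mul_periodization_eq_one {d s : ℕ} {α β : (Fin d → ℤ) → ℝ}
    (hα : ∀ x, α x ≠ 0 → ∀ i, |x i| ≤ (s : ℤ)) (hβ : Summable fun m => |β m|)
    (hconv : ∀ m, (∑ᶠ k, α k * β (m - k)) = if m = 0 then 1 else 0)
    (ρ : (Fin d → ℤ) → DCube d s) (hρ : ∀ m i, (2 * (s : ℤ) + 1) ∣ (ρ m).emb i - m i) :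
    (Matrix.of fun j k : DCube d s => α (ρ (j.emb - k.emb)).emb) *
      (Matrix.of fun j k : DCube d s => ∑' n, if j = ρ (n + k.emb) then β n else 0) = 1 := by
  have hbd : ∀ (j : DCube d s) i, |j.emb i| ≤ (s : ℤ) := fun j i => abs_le.2 (j i).2
  have hfin : (Function.support α).Finite :=
    (Set.Finite.pi' fun _ : Fin d => Set.finite_Icc (-(s : ℤ)) s).subset
      fun x hx i => abs_le.1 (hα x hx i)
  have hρ_eq : ∀ (j : DCube d s) m, j = ρ m ↔ ∀ i, (2 * (s : ℤ) + 1) ∣ j.emb i - m i := by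
    refine fun j m => ⟨fun h => h ▸ hρ m, fun h => funext fun i => Subtype.ext ?_⟩
    refine int_eq_of_dvd_sub_of_abs_le (hbd j i) (hbd (ρ m) i) ?_
    simpa [DCube.emb] using dvd_sub (h i) (hρ m i)
  have hemb_eq : ∀ x m : Fin d → ℤ, α x ≠ 0 →
      ((ρ m).emb = x ↔ ∀ i, (2 * (s : ℤ) + 1) ∣ x i - m i) := by
    refine fun x m hx => ⟨fun h => h ▸ hρ m, fun h => funext fun i => ?_⟩
    refine int_eq_of_dvd_sub_of_abs_le (hbd (ρ m) i) (hα x hx i) ?_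
    simpa using dvd_sub (hρ m i) (h i)
  have hper : ∀ m, α (ρ m).emb = ∑ x ∈ hfin.toFinset, if (ρ m).emb = x then α x else 0 := by
    intro m
    rw [Finset.sum_ite_eq]
    by_cases h : α (ρ m).emb = 0 <;> simp [h]
  ext j k
  have hiff : ∀ n x, α x ≠ 0 →
      ((ρ (j.emb - (ρ (n + k.emb)).emb)).emb = x ↔ j = ρ (n + x + k.emb)) := by
    intro n x hx
    rw [hemb_eq _ _ hx, hρ_eq]
    refine forall_congr' fun i => ?_
    have h := hρ (n + k.emb) i
    have e : x i - (j.emb - (ρ (n + k.emb)).emb) i =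
        ((ρ (n + k.emb)).emb i - (n + k.emb) i) - (j.emb i - (n + x + k.emb) i) := by
      simp only [Pi.sub_apply, Pi.add_apply]; ring
    rw [e, dvd_sub_right h]
  have hsum : ∀ x, Summable fun n => (if j = ρ (n + x + k.emb) then β n else 0) :=
    fun x => summable_ite_of_summable_abs hβ _
  simp only [Matrix.mul_apply, Matrix.of_apply]
  calc ∑ j', α (ρ (j.emb - j'.emb)).emb * ∑' n, (if j' = ρ (n + k.emb) then β n else 0)
      = ∑' n, ∑ j', α (ρ (j.emb - j'.emb)).emb * (if j' = ρ (n + k.emb) then β n else 0) := by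
        rw [Summable.tsum_finsetSum fun j' _ =>
          (summable_ite_of_summable_abs hβ _).mul_left _]
        simp only [tsum_mul_left]
    _ = ∑' n, ∑ x ∈ hfin.toFinset, α x * (if j = ρ (n + x + k.emb) then β n else 0) := by
        refine tsum_congr fun n => ?_
        simp only [mul_ite, mul_zero, Finset.sum_ite_eq', Finset.mem_univ, if_true]
        rw [hper, Finset.sum_mul]
        refine Finset.sum_congr rfl fun x hx => ?_
        have hx : α x ≠ 0 := by simpa using hx
        simp only [hiff n x hx, ite_mul, zero_mul]
    _ = ∑ x ∈ hfin.toFinset, α x * ∑' n, (if j = ρ (n + x + k.emb) then β n else 0) := by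
        rw [Summable.tsum_finsetSum fun x _ => (hsum x).mul_left _]
        simp only [tsum_mul_left]
    _ = ∑ x ∈ hfin.toFinset, α x * ∑' m, (if j = ρ (m + k.emb) then β (m - x) else 0) := by
        refine Finset.sum_congr rfl fun x _ => congrArg _ ?_
        rw [← (Equiv.addRight x).tsum_eq fun m => if j = ρ (m + k.emb) then β (m - x) else 0]
        simp
    _ = ∑' m, ∑ x ∈ hfin.toFinset, α x * (if j = ρ (m + k.emb) then β (m - x) else 0) := by
        rw [Summable.tsum_finsetSum fun x _ => Summable.mul_left _ ?_]
        · simp only [tsum_mul_left]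
        · exact summable_ite_of_summable_abs ((Equiv.subRight x).summable_iff.2 hβ) _
    _ = ∑' m : Fin d → ℤ, if m = 0 then (if j = ρ k.emb then 1 else 0) else 0 := by
        refine tsum_congr fun m => ?_
        have hm : ∑ x ∈ hfin.toFinset, α x * β (m - x) = if m = 0 then 1 else 0 := by
          rw [← hconv m]
          refine (finsum_eq_sum_of_support_subset _ fun x hx => ?_).symm
          simpa using left_ne_zero_of_mul hx
        by_cases hj : j = ρ (m + k.emb)
        · simp only [← hj, if_true, hm]
          by_cases h0 : m = 0
          · subst h0
            simpa using hj
          · simp [h0]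
        · simp only [hj, if_false, mul_zero, Finset.sum_const_zero]
          by_cases h0 : m = 0
          · subst h0
            simpa using hj
          · simp [h0]
    _ = (1 : Matrix (DCube d s) (DCube d s) ℝ) j k := by
        have hk : ρ k.emb = k := ((hρ_eq k k.emb).2 fun i => by simp).symm
        rw [tsum_ite_eq, hk, Matrix.one_apply]

/-- **Proposition 3 of the paper**: with `supp α ⊆ Λ_D`, `R = r + D`, `l > R`,
`Γ = (2(l+R)+1)ℤ^d`, and `π : ℤ^d → Q_{l+R}` the `Γ`-periodization map, the circulant
matrix `A_Λ(j,k) = α_{π(j-k)}` satisfies the compatibility condition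
`A_Λ(j,k) = α_{j-k}` for `j ∈ Q_{l+r}`, `k ∈ Q_{l+R}`, is invertible, and the column sum
norm of its inverse `B_Λ = A_Λ⁻¹` is bounded by `‖B‖₁ = ∑_n |β_n| < ∞`, the
`ℓ¹`-operator norm of the inverse `B` of the Laurent operator `A` of `α`, represented
here by its convolution kernel `β` (the convolution inverse of `α`, which is summable). -/
theorem circulant_matrix_inverse_bound
    (d : ℕ) (hd : 1 ≤ d) (D r : ℕ) (R : ℕ) (hRdef : R = r + D) (l : ℕ) (hl : R < l)
    (α : (Fin d → ℤ) → ℝ)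
    (hαsupp : ∀ x : Fin d → ℤ, α x ≠ 0 → ∀ i, |x i| ≤ (D : ℤ))
    (hαhat : ∀ θ : Fin d → ℝ, (∀ i, θ i ∈ Set.Ico (0 : ℝ) (2 * Real.pi)) → fhat d α θ ≠ 0)
    -- the convolution kernel β of the inverse B of the Laurent operator A of α
    (β : (Fin d → ℤ) → ℝ) (hβ : Summable fun m => |β m|)
    (hβconv : ∀ m : Fin d → ℤ,
      (∑ᶠ k : Fin d → ℤ, α k * β (m - k)) = if m = 0 then 1 else 0)
    -- the periodization map π : ℤ^d → Q_{l+R} ∩ (m + Γ), Γ = (2(l+R)+1)ℤ^d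
    (π : (Fin d → ℤ) → (Fin d → ℤ))
    (hπ1 : ∀ m i, |π m i| ≤ ((l : ℤ) + R))
    (hπ2 : ∀ m i, ((2 * ((l : ℤ) + R) + 1)) ∣ (π m i - m i))
    -- the circulant matrix A_Λ
    (AΛ : Matrix (DCube d (l + R)) (DCube d (l + R)) ℝ)
    (hAΛ : ∀ j k : DCube d (l + R), AΛ j k = α (π (j.emb - k.emb))) :
    (∀ j k : DCube d (l + R), (∀ i, |(j i : ℤ)| ≤ ((l : ℤ) + r)) →
        AΛ j k = α (j.emb - k.emb)) ∧
      IsUnit AΛ ∧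
      ∀ k : DCube d (l + R), ∑ j : DCube d (l + R), |AΛ⁻¹ j k| ≤ ∑' n, |β n| := by
  have hcast : ((l + R : ℕ) : ℤ) = (l : ℤ) + R := by push_cast; rfl
  let ρ : (Fin d → ℤ) → DCube d (l + R) := fun m i =>
    ⟨π m i, abs_le.1 (by rw [hcast]; exact hπ1 m i)⟩
  have hA : AΛ = Matrix.of fun j k : DCube d (l + R) => α (ρ (j.emb - k.emb)).emb := by
    ext j k
    exact hAΛ j k
  have hmul := mul_periodization_eq_one (s := l + R)
    (fun x hx i => (hαsupp x hx i).trans (by omega)) hβ hβconv ρ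
    (fun m i => by rw [hcast]; exact hπ2 m i)
  rw [← hA] at hmul
  refine ⟨fun j k hj => ?_, IsUnit.of_mul_eq_one _ hmul, fun k => ?_⟩
  · rw [hAΛ]
    by_cases hsmall : ∀ i, |(j.emb - k.emb) i| ≤ (l : ℤ) + R
    · exact congrArg α (funext fun i =>
        int_eq_of_dvd_sub_of_abs_le (hπ1 _ i) (hsmall i) (hπ2 _ i))
    · push Not at hsmall
      obtain ⟨i, hi⟩ := hsmall
      have hzero : α (j.emb - k.emb) = 0 := by
        by_contra h
        have := hαsupp _ h i
        omega
      rw [hzero]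
      by_contra h
      have hD := hαsupp _ h i
      have hji : |j.emb i| ≤ (l : ℤ) + r := hj i
      have hki : |k.emb i| ≤ (l : ℤ) + R := abs_le.2 (by rw [← hcast]; exact (k i).2)
      have heq := Int.eq_zero_of_abs_lt_dvd (hπ2 (j.emb - k.emb) i) (by
        simp only [Pi.sub_apply] at *
        grind)
      grind
  · rw [Matrix.inv_eq_right_inv hmul]
    exact sum_abs_tsum_fiber_le hβ fun n => ρ (n + k.emb)

end
end

section
/- Let d ≥ 1 and let α : ℤ^d → ℂ be finitely supported such that its Fourier transform α̂(θ) = Σ_{k∈ℤ^d} α_k e^{−i⟨k,θ⟩} is nonzero for every θ ∈ ℝ^d. Then there exists β : ℤ^d → ℂ with Σ_{n∈ℤ^d} |β_n| < ∞ such that Σ_{n∈ℤ^d} β_n e^{−i⟨n,θ⟩} = 1/α̂(θ) for all θ ∈ ℝ^d; equivalently, the convolution α * β equals the Kronecker delta at 0, i.e. Σ_{k∈ℤ^d} α_k β_{m−k} = 1 if m = 0 and = 0 otherwise. -/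
noncomputable section

/-- The Fourier transform `α̂(θ) = ∑_k α_k e^{-i⟨k,θ⟩}` of a (finitely supported)
sequence `α : ℤ^d → ℂ`. -/
def fhatC (d : ℕ) (α : (Fin d → ℤ) → ℂ) (θ : Fin d → ℝ) : ℂ :=
  ∑ᶠ k : Fin d → ℤ, α k * Complex.exp (-Complex.I * ∑ i, (k i : ℂ) * (θ i : ℂ))

open Complex

/-- Gelfand theory for absolutely convergent group representations: if `S` is a representation of
a commutative group by contractions in a complex Banach algebra and the finite combination
`∑ α g χ(g)` is nonzero for every unitary character `χ`, then `∑ α g • S g` is invertible. -/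
theorem isUnit_sum_smul_of_forall_character {G B : Type*} [CommGroup G] [NormedRing B]
    [NormedAlgebra ℂ B] [CompleteSpace B] (S : G →* B) (hS : ∀ g, ‖S g‖ ≤ 1)
    (s : Finset G) (α : G → ℂ)
    (h : ∀ χ : G →* ℂ, (∀ g, ‖χ g‖ = 1) → ∑ g ∈ s, α g * χ g ≠ 0) :
    IsUnit (∑ g ∈ s, α g • S g) := by
  have hcomm : ∀ x ∈ Set.range S, ∀ y ∈ Set.range S, x * y = y * x := by
    rintro _ ⟨a, rfl⟩ _ ⟨b, rfl⟩
    rw [← map_mul, mul_comm, map_mul]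
  have := Algebra.isMulCommutative_adjoin ℂ hcomm
  let A : Subalgebra ℂ B := (Algebra.adjoin ℂ (Set.range S)).topologicalClosure
  have hA : ∀ x y : A, x * y = y * x :=
    (Subalgebra.commRingTopologicalClosure (Algebra.adjoin ℂ (Set.range S))
      fun x y => Subtype.ext (setLike_mul_comm x.2 y.2)).mul_comm
  let _ : NormedCommRing A := { (inferInstance : NormedRing A) with mul_comm := hA }
  have : CompleteSpace A :=
    (Subalgebra.isClosed_topologicalClosure (Algebra.adjoin ℂ (Set.range S))).completeSpace_coe
  let T : G →* A := S.codRestrict A fun g =>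
    Subalgebra.le_topologicalClosure _ (Algebra.subset_adjoin ⟨g, rfl⟩)
  have hT : ∀ g, ‖T g‖ ≤ 1 := hS
  suffices hu : IsUnit (∑ g ∈ s, α g • T g) by
    have := hu.map A.val
    rw [map_sum] at this
    exact this
  by_contra hu
  obtain ⟨φ, hφ⟩ := WeakDual.CharacterSpace.exists_apply_eq_zero hu
  have hle : ∀ g, ‖φ (T g)‖ ≤ 1 := fun g => by
    have h1 : ‖(1 : A)‖ ≤ 1 := by simpa using hT 1
    exact (AlgHom.norm_apply_le_self_mul_norm_one φ (T g)).trans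
      (mul_le_one₀ (hT g) (norm_nonneg _) h1)
  refine h ((φ : A →* ℂ).comp T) (fun g => le_antisymm (hle g) ?_) ?_
  · have h1 : ‖φ (T g)‖ * ‖φ (T g⁻¹)‖ = 1 := by
      rw [← norm_mul, ← map_mul, ← map_mul, mul_inv_cancel, map_one, map_one, norm_one]
    calc 1 = ‖φ (T g)‖ * ‖φ (T g⁻¹)‖ := h1.symm
      _ ≤ ‖φ (T g)‖ := mul_le_of_le_one_right (norm_nonneg _) (hle _)
  · simpa [map_sum] using hφ

section Translation

variable {G : Type*} [AddCommGroup G]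

theorem summable_norm_of_mem_lp_one {ι : Type*} (f : lp (fun _ : ι => ℂ) 1) :
    Summable fun n => ‖f n‖ := by
  simpa using (memℓp_gen_iff (by simp)).1 f.2

/-- Translation by `g` on `ℓ¹(G)`, as a continuous linear map. -/
def lpTranslate (g : G) : lp (fun _ : G => ℂ) 1 →L[ℂ] lp (fun _ : G => ℂ) 1 :=
  LinearMap.mkContinuous
    { toFun := fun f => ⟨fun x => f (x - g), memℓp_gen <| by
        simpa [Function.comp_def] using
          (Equiv.subRight g).summable_iff.2 (summable_norm_of_mem_lp_one f)⟩
      map_add' := fun _ _ => rfl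
      map_smul' := fun _ _ => rfl } 1 fun f => by
    rw [one_mul, lp.norm_eq_tsum_rpow (by simp), lp.norm_eq_tsum_rpow (by simp)]
    simp only [ENNReal.toReal_one, Real.rpow_one, div_one]
    exact ((Equiv.subRight g).tsum_eq fun x => ‖f x‖).le

@[simp]
theorem lpTranslate_apply (g : G) (f : lp (fun _ : G => ℂ) 1) (x : G) :
    lpTranslate g f x = f (x - g) := rfl

theorem norm_lpTranslate_le (g : G) : ‖lpTranslate g‖ ≤ 1 :=
  LinearMap.mkContinuous_norm_le _ zero_le_one _

/-- The translation representation of `G` on `ℓ¹(G)`. -/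
def lpTranslateHom : Multiplicative G →*
    (lp (fun _ : G => ℂ) 1 →L[ℂ] lp (fun _ : G => ℂ) 1) where
  toFun g := lpTranslate g.toAdd
  map_one' := by
    ext f x
    simp
  map_mul' g h := by
    ext f x
    simp [sub_sub]

/-- A finitely supported sequence on `G` without zeros of its Fourier transform on the unitary
characters has a convolution inverse in `ℓ¹(G)`. -/
theorem exists_summable_convolution_inverse [DecidableEq G] (s : Finset G) (α : G → ℂ)
    (h : ∀ χ : Multiplicative G →* ℂ, (∀ g, ‖χ g‖ = 1) →
      ∑ k ∈ s, α k * χ (Multiplicative.ofAdd k) ≠ 0) :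
    ∃ β : G → ℂ, Summable (fun n => ‖β n‖) ∧
      ∀ m, ∑ k ∈ s, α k * β (m - k) = if m = 0 then 1 else 0 := by
  have hu : IsUnit (∑ k ∈ s, α k • lpTranslate k) := by
    have := isUnit_sum_smul_of_forall_character (lpTranslateHom (G := G))
      (fun g => norm_lpTranslate_le _) (s.map Multiplicative.ofAdd.toEmbedding)
      (fun g => α g.toAdd) (fun χ hχ => by simpa using h χ hχ)
    simpa [lpTranslateHom] using this
  obtain ⟨u, hu⟩ := hu.exists_right_inv
  let β := u (lp.single 1 0 1)
  refine ⟨β, summable_norm_of_mem_lp_one β, fun m => ?_⟩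
  have hβ : (∑ k ∈ s, α k • lpTranslate k) β = lp.single 1 0 1 :=
    DFunLike.congr_fun hu (lp.single 1 0 1)
  have := congrArg (lp.evalCLM ℂ (fun _ : G => ℂ) 1 m) hβ
  simpa [sum_apply, map_sum, Pi.single_apply, lp.evalCLM] using this

/-- The Fourier transform of an `ℓ¹` convolution inverse is the pointwise inverse. -/
theorem tsum_mul_eq_inv_of_convolution [DecidableEq G] (s : Finset G) (α β : G → ℂ)
    (hβ : Summable fun n => ‖β n‖)
    (hαβ : ∀ m, ∑ k ∈ s, α k * β (m - k) = if m = 0 then 1 else 0)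
    (e : G → ℂ) (he0 : e 0 = 1) (he : ∀ a b, e (a + b) = e a * e b) (hnorm : ∀ a, ‖e a‖ = 1) :
    ∑' n, β n * e n = (∑ k ∈ s, α k * e k)⁻¹ := by
  have hsum : Summable fun n => β n * e n := Summable.of_norm <| by simpa [hnorm] using hβ
  have hk : ∀ k, HasSum (fun m => α k * β (m - k) * e m) (α k * e k * ∑' n, β n * e n) := by
    intro k
    have := ((Equiv.subRight k).hasSum_iff.2 hsum.hasSum).mul_left (α k * e k)
    refine (congrArg (HasSum · _) (funext fun m => ?_)).mpr this
    have hm : e m = e k * e (m - k) := by rw [← he, add_sub_cancel]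
    simp only [Function.comp_apply, Equiv.subRight_apply, hm]
    ring
  have h1 := hasSum_sum fun k (_ : k ∈ s) => hk k
  simp_rw [← Finset.sum_mul, hαβ] at h1
  have h2 : HasSum (fun m : G => (if m = 0 then 1 else 0) * e m) 1 := by
    convert hasSum_ite_eq (0 : G) (1 : ℂ) using 1
    funext m
    split_ifs with hm <;> simp [hm, he0]
  exact eq_inv_of_mul_eq_one_right (h1.unique h2)

end Translation

/-- Every unitary character of `ℤ^d` has the form `k ↦ e^{-i⟨k,θ⟩}`. -/
theorem exists_angle_of_character {d : ℕ} (χ : Multiplicative (Fin d → ℤ) →* ℂ)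
    (hχ : ∀ g, ‖χ g‖ = 1) :
    ∃ θ : Fin d → ℝ, ∀ k : Fin d → ℤ,
      χ (Multiplicative.ofAdd k) = exp (-I * ∑ i, (k i : ℂ) * (θ i : ℂ)) := by
  let g (i : Fin d) : Multiplicative (Fin d → ℤ) := Multiplicative.ofAdd (Pi.single i 1)
  refine ⟨fun i => -arg (χ (g i)), fun k => ?_⟩
  have hg : ∀ i, χ (g i) = exp (arg (χ (g i)) * I) := fun i => by
    conv_lhs => rw [← norm_mul_exp_arg_mul_I (χ (g i)), hχ, ofReal_one, one_mul]
  have hk : Multiplicative.ofAdd k = ∏ i, g i ^ k i := by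
    apply Multiplicative.toAdd.injective
    simp only [toAdd_ofAdd, toAdd_prod, toAdd_zpow, g]
    ext j
    simp [Finset.sum_apply, Pi.single_apply]
  have hpow : ∀ i, χ (g i ^ k i) = χ (g i) ^ k i := fun i => by
    simp
  rw [hk, map_prod, Finset.mul_sum, exp_sum]
  refine Finset.prod_congr rfl fun i _ => ?_
  rw [hpow, congrArg (· ^ k i) (hg i), ← exp_int_mul]
  congr 1
  push_cast
  ring

/-- **Wiener's 1/f theorem** on the `d`-dimensional torus, specialised to a finitely
supported symbol: if `α : ℤ^d → ℂ` is finitely supported and `α̂` vanishes nowhere, then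
`1/α̂` has an absolutely convergent Fourier series `β`, i.e. there is a summable
`β : ℤ^d → ℂ` with `∑_n β_n e^{-i⟨n,θ⟩} = 1/α̂(θ)` for all `θ`; equivalently `α * β` is
the Kronecker delta at `0`. -/
theorem wiener_one_over_f
    (d : ℕ) (hd : 1 ≤ d)
    (α : (Fin d → ℤ) → ℂ) (hαfin : (Function.support α).Finite)
    (hαhat : ∀ θ : Fin d → ℝ, fhatC d α θ ≠ 0) :
    ∃ β : (Fin d → ℤ) → ℂ, Summable (fun n => ‖β n‖) ∧
      (∀ θ : Fin d → ℝ,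
        (∑' n : Fin d → ℤ, β n * Complex.exp (-Complex.I * ∑ i, (n i : ℂ) * (θ i : ℂ))) =
          (fhatC d α θ)⁻¹) ∧
      (∀ m : Fin d → ℤ,
        (∑ᶠ k : Fin d → ℤ, α k * β (m - k)) = if m = 0 then 1 else 0) := by
  have hfin : ∀ f : (Fin d → ℤ) → ℂ,
      ∑ᶠ k, α k * f k = ∑ k ∈ hαfin.toFinset, α k * f k := fun f =>
    finsum_eq_sum_of_support_subset _ fun k hk => by
      simpa using left_ne_zero_of_mul hk
  have hfhat : ∀ θ, fhatC d α θ = ∑ k ∈ hαfin.toFinset,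
      α k * exp (-I * ∑ i, (k i : ℂ) * (θ i : ℂ)) := fun θ => hfin _
  obtain ⟨β, hβ, hαβ⟩ := exists_summable_convolution_inverse hαfin.toFinset α fun χ hχ => by
    obtain ⟨θ, hθ⟩ := exists_angle_of_character χ hχ
    simpa only [hθ, ← hfhat] using hαhat θ
  refine ⟨β, hβ, fun θ => ?_, fun m => (hfin _).trans (hαβ m)⟩
  rw [hfhat]
  refine tsum_mul_eq_inv_of_convolution _ α β hβ hαβ _ (by simp) (fun a b => ?_) fun a => ?_
  · rw [← exp_add, ← mul_add, ← Finset.sum_add_distrib]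
    simp [add_mul]
  · have : -I * ∑ i, (a i : ℂ) * (θ i : ℂ) = ((-∑ i, (a i : ℝ) * θ i : ℝ) : ℂ) * I := by
      push_cast
      ring
    rw [this, norm_exp_ofReal_mul_I]

end
end

section
/- Let Q be a finite set, j ∈ Q, and let H be a Hermitian operator on ℓ²(Q) = ℂ^Q. Let w : Q → ℝ satisfy w(x) ≥ 1_{{j}}(x) for all x ∈ Q, let M_w denote the corresponding multiplication operator, and for t ∈ ℝ set H_t := H + t·M_w. Let I = [E₁,E₂] be a compact interval and let P_t(I) denote the spectral projection of H_t onto I. Let χ_j denote multiplication by the indicator function of {j}. Then for every bounded, compactly supported measurable g : ℝ → [0,∞) and every φ ∈ ℓ²(Q) with ‖φ‖ = 1, ∫_ℝ g(t) ⟨φ, χ_j P_t(I) χ_j φ⟩ dt ≤ (E₂ − E₁) · ‖g‖_∞. -/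
open MeasureTheory Matrix

noncomputable section

/-- Multiplication by the indicator function of the site `j`, as a matrix. -/
def chi {n : Type*} [Fintype n] [DecidableEq n] (j : n) : Matrix n n ℂ :=
  Matrix.diagonal fun q => if q = j then (1 : ℂ) else 0

/-- If `F` is holomorphic on the closed lower half plane, asymptotic to `c / z` there, and has
nonnegative imaginary part on the real line, then `∫ Im F ≤ c π`. -/
theorem lintegral_im_le_of_asymptotic {F : ℂ → ℂ} {c K : ℝ} (hc : 0 ≤ c)
    (hd : ∀ z : ℂ, z.im ≤ 0 → DifferentiableAt ℂ F z)
    (hK : ∀ z : ℂ, z.im ≤ 0 → z ≠ 0 → ‖F z - c / (z - Complex.I)‖ ≤ K / ‖z‖ ^ 2)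
    (hpos : ∀ x : ℝ, 0 ≤ (F x).im) :
    ∫⁻ x : ℝ, ENNReal.ofReal (F x).im ≤ ENNReal.ofReal (c * Real.pi) := by
  have hK0 : 0 ≤ K := by
    have := (norm_nonneg _).trans (hK 1 (by simp) one_ne_zero)
    simpa using this
  have hne : ∀ z : ℂ, z.im ≤ 0 → z - Complex.I ≠ 0 := by
    intro z hz h
    have := congrArg Complex.im h
    simp at this
    linarith
  set f : ℂ → ℂ := fun z => F z - c / (z - Complex.I) with hf
  have hfd : ∀ z : ℂ, z.im ≤ 0 → DifferentiableAt ℂ f z := fun z hz =>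
    (hd z hz).sub ((differentiableAt_const _).div (by fun_prop) (hne z hz))
  have hfc : Continuous fun x : ℝ => f x := continuous_iff_continuousAt.2 fun x =>
    ContinuousAt.comp (f := fun x : ℝ => (x : ℂ)) (hfd x (by simp)).continuousAt
      Complex.continuous_ofReal.continuousAt
  have hFc : Continuous fun x : ℝ => F x := continuous_iff_continuousAt.2 fun x =>
    ContinuousAt.comp (f := fun x : ℝ => (x : ℂ)) (hd x (by simp)).continuousAt
      Complex.continuous_ofReal.continuousAt
  have him : ∀ x : ℝ, (F x).im = (f x).im + c * (1 + x ^ 2)⁻¹ := by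
    intro x
    simp only [hf, Complex.sub_im, Complex.div_im, Complex.ofReal_re, Complex.ofReal_im,
      Complex.normSq_apply, Complex.sub_re, Complex.I_re, Complex.I_im]
    have : (0 : ℝ) < 1 + x ^ 2 := by positivity
    have h2 : (x - 0) * (x - 0) + (0 - 1) * (0 - 1) = 1 + x ^ 2 := by ring
    rw [h2]
    field_simp
    ring
  have hside : ∀ R : ℝ, 0 < R → ∀ z : ℂ, z.im ≤ 0 → R ≤ ‖z‖ → ‖f z‖ ≤ K / R ^ 2 := by
    intro R hR z hz hRz
    refine (hK z hz (norm_pos_iff.1 (hR.trans_le hRz))).trans ?_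
    gcongr
  have hrect : ∀ R : ℝ, 0 < R → ‖∫ x : ℝ in (-R)..R, f x‖ ≤ 4 * K / R := by
    intro R hR
    have key := Complex.integral_boundary_rect_eq_zero_of_differentiableOn f ⟨-R, -R⟩ ⟨R, 0⟩ (by
      intro z hz
      refine (hfd z ?_).differentiableWithinAt
      have := hz.2
      simp only [Set.mem_preimage, Set.uIcc_of_le (by linarith : -R ≤ 0), Set.mem_Icc] at this
      exact this.2)
    simp only [Complex.ofReal_zero, zero_mul, add_zero] at key
    have h1 : ‖∫ x : ℝ in (-R)..R, f (x + ((-R : ℝ) : ℂ) * Complex.I)‖ ≤ K / R ^ 2 * |R - -R| := by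
      refine intervalIntegral.norm_integral_le_of_norm_le_const fun x _ => ?_
      refine hside R hR _ (by simp [hR.le]) ?_
      refine le_trans ?_ (Complex.abs_im_le_norm _)
      simp [abs_of_pos hR]
    have h2 : ∀ s : ℝ, |s| = R →
        ‖∫ y : ℝ in (-R)..0, f ((s : ℂ) + y * Complex.I)‖ ≤ K / R ^ 2 * |0 - -R| := by
      intro s hs
      refine intervalIntegral.norm_integral_le_of_norm_le_const fun y hy => ?_
      rw [Set.uIoc_of_le (by linarith)] at hy
      refine hside R hR _ (by simpa using hy.2) ?_
      refine le_trans ?_ (Complex.abs_re_le_norm _)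
      simp [hs]
    have h2a := h2 R (abs_of_pos hR)
    have h2b := h2 (-R) (by rw [abs_neg, abs_of_pos hR])
    rw [show (∫ x : ℝ in (-R)..R, f x) = (∫ x : ℝ in (-R)..R, f (x + ((-R : ℝ) : ℂ) * Complex.I))
      + Complex.I • (∫ y : ℝ in (-R)..0, f ((R : ℂ) + y * Complex.I))
      - Complex.I • (∫ y : ℝ in (-R)..0, f (((-R : ℝ) : ℂ) + y * Complex.I)) by
        linear_combination -key]
    refine (norm_sub_le _ _).trans ?_
    refine (add_le_add_left (norm_add_le _ _) _).trans ?_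
    rw [norm_smul, norm_smul, Complex.norm_I, one_mul, one_mul]
    have e1 : |R - -R| = 2 * R := by rw [abs_of_pos] <;> linarith
    have e2 : |0 - -R| = R := by rw [abs_of_pos] <;> linarith
    rw [e1] at h1
    rw [e2] at h2a h2b
    have : 4 * K / R = K / R ^ 2 * (2 * R) + K / R ^ 2 * R + K / R ^ 2 * R := by
      field_simp; ring
    linarith
  have hbound : ∀ R : ℝ, 0 < R →
      ∫⁻ x in Set.Ioc (-R) R, ENNReal.ofReal (F x).im ≤
        ENNReal.ofReal (c * Real.pi + 4 * K / R) := by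
    intro R hR
    have hint : Continuous fun x : ℝ => (F x).im := Complex.continuous_im.comp hFc
    rw [← ofReal_integral_eq_lintegral_ofReal
      ((hint.intervalIntegrable (-R) R).1) (Filter.Eventually.of_forall hpos),
      ← intervalIntegral.integral_of_le (by linarith)]
    refine ENNReal.ofReal_le_ofReal ?_
    have hinv : Continuous fun x : ℝ => c * (1 + x ^ 2)⁻¹ :=
      continuous_const.mul (Continuous.inv₀ (by fun_prop) fun x => by positivity)
    have hfim : Continuous fun x : ℝ => (f x).im := Complex.continuous_im.comp hfc
    simp_rw [him]
    rw [intervalIntegral.integral_add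
      (hfim.intervalIntegrable _ _) (hinv.intervalIntegrable _ _),
      intervalIntegral.integral_const_mul, integral_inv_one_add_sq]
    have h1 : ∫ x : ℝ in (-R)..R, (f x).im = (∫ x : ℝ in (-R)..R, f x).im :=
      Complex.imCLM.intervalIntegral_comp_comm (hfc.intervalIntegrable _ _)
    have h2 := (Complex.abs_im_le_norm _).trans (hrect R hR)
    have h3 := Real.arctan_lt_pi_div_two R
    have h4 := Real.neg_pi_div_two_lt_arctan (-R)
    have h5 : c * (Real.arctan R - Real.arctan (-R)) ≤ c * Real.pi := by
      gcongr
      linarith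
    rw [h1]
    linarith [le_abs_self (∫ x : ℝ in (-R)..R, f x).im]
  refine le_of_tendsto_of_tendsto
    ((aecover_Ioc Filter.tendsto_neg_atTop_atBot
      Filter.tendsto_id).lintegral_tendsto_of_countably_generated
      (Complex.continuous_im.comp hFc).measurable.ennreal_ofReal.aemeasurable)
    (ENNReal.tendsto_ofReal (f := Filter.atTop) (m := fun R : ℝ => c * Real.pi + 4 * K / R) ?_)
    ((Filter.eventually_gt_atTop 0).mono hbound)
  simpa using (tendsto_const_nhds (x := c * Real.pi)).add
    ((Filter.tendsto_id (α := ℝ) (x := Filter.atTop)).const_div_atTop (4 * K))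

/-- A matrix `A` with `ε ‖v‖² ≤ |⟨v, A v⟩|` is invertible. -/
theorem det_ne_zero_of_coercive {n : Type*} [Fintype n] [DecidableEq n] {A : Matrix n n ℂ} {ε : ℝ}
    (hε : 0 < ε) (hA : ∀ v : n → ℂ, ε * ∑ q, ‖v q‖ ^ 2 ≤ ‖star v ⬝ᵥ A *ᵥ v‖) : A.det ≠ 0 := by
  intro h
  obtain ⟨v, hv, hAv⟩ := Matrix.exists_mulVec_eq_zero_iff.2 h
  have h1 := hA v
  rw [hAv, dotProduct_zero, norm_zero] at h1
  have h2 : ∑ q, ‖v q‖ ^ 2 ≤ 0 := by nlinarith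
  refine hv (funext fun q => ?_)
  have h3 := (Finset.single_le_sum (f := fun q => ‖v q‖ ^ 2) (fun i _ => by positivity)
    (Finset.mem_univ q)).trans h2
  simpa using le_antisymm h3 (by positivity)

/-- The inverse of a matrix `A` with `ε ‖v‖² ≤ |⟨v, A v⟩|` is bounded by `1 / ε`. -/
theorem norm_sq_inv_mulVec_le_of_coercive {n : Type*} [Fintype n] [DecidableEq n]
    {A : Matrix n n ℂ} {ε : ℝ}
    (hε : 0 < ε) (hA : ∀ v : n → ℂ, ε * ∑ q, ‖v q‖ ^ 2 ≤ ‖star v ⬝ᵥ A *ᵥ v‖)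
    (u : n → ℂ) (k : n) : ‖(A⁻¹ *ᵥ u) k‖ ^ 2 ≤ (∑ q, ‖u q‖ ^ 2) / ε ^ 2 := by
  have hdet := det_ne_zero_of_coercive hε hA
  have h1 := hA (A⁻¹ *ᵥ u)
  set v := A⁻¹ *ᵥ u with hv
  rw [hv, mulVec_mulVec, Matrix.mul_nonsing_inv _ (isUnit_iff_ne_zero.2 hdet), one_mulVec,
    ← hv] at h1
  have h2 : ‖star v ⬝ᵥ u‖ ≤ ∑ q, (ε / 2 * ‖v q‖ ^ 2 + ‖u q‖ ^ 2 / (2 * ε)) := by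
    refine (norm_sum_le _ _).trans (Finset.sum_le_sum fun q _ => ?_)
    rw [norm_mul, Pi.star_apply, norm_star]
    have : ε / 2 * ‖v q‖ ^ 2 + ‖u q‖ ^ 2 / (2 * ε) - ‖v q‖ * ‖u q‖ =
        (ε * ‖v q‖ - ‖u q‖) ^ 2 / (2 * ε) := by field_simp; ring
    have h0 : 0 ≤ (ε * ‖v q‖ - ‖u q‖) ^ 2 / (2 * ε) := by positivity
    linarith
  rw [Finset.sum_add_distrib, ← Finset.mul_sum, ← Finset.sum_div] at h2
  have h3 := Finset.single_le_sum (f := fun q => ‖v q‖ ^ 2) (fun i _ => by positivity)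
    (Finset.mem_univ k)
  refine h3.trans ?_
  have h4 : ε / 2 * ∑ q, ‖v q‖ ^ 2 ≤ (∑ q, ‖u q‖ ^ 2) / (2 * ε) := by linarith
  rw [le_div_iff₀ (by positivity)] at h4 ⊢
  nlinarith

theorem differentiableAt_det {n : Type*} [Fintype n] [DecidableEq n] {A : ℂ → Matrix n n ℂ} {x : ℂ}
    (hA : ∀ i j, DifferentiableAt ℂ (fun τ => A τ i j) x) :
    DifferentiableAt ℂ (fun τ => (A τ).det) x := by
  simp only [det_apply]
  fun_prop

theorem differentiableAt_inv_apply {n : Type*} [Fintype n] [DecidableEq n] {A : ℂ → Matrix n n ℂ}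
    {x : ℂ} (hA : ∀ i j, DifferentiableAt ℂ (fun τ => A τ i j) x) (hx : (A x).det ≠ 0) (i j : n) :
    DifferentiableAt ℂ (fun τ => (A τ)⁻¹ i j) x := by
  simp only [inv_def, Ring.inverse_eq_inv', Matrix.smul_apply, smul_eq_mul, adjugate_apply]
  refine ((differentiableAt_det hA).inv hx).mul (differentiableAt_det fun k l => ?_)
  by_cases h : k = j
  · subst h
    simp
  · simpa [updateRow_apply, h] using hA k l

/-- The diagonal entry at `j` of the resolvent `(H + τ w - z)⁻¹`. -/
def resolventEntry {n : Type*} [Fintype n] [DecidableEq n] (H : Matrix n n ℂ) (w : n → ℝ) (j : n)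
    (z τ : ℂ) : ℂ :=
  (H + τ • diagonal (fun q => (w q : ℂ)) - z • 1)⁻¹ j j

section
variable {n : Type*} [Fintype n] [DecidableEq n] {H : Matrix n n ℂ} {w : n → ℝ} {j : n}

theorem coercive_sub_smul_one (hH : H.IsHermitian) (hw : ∀ q, 0 ≤ w q) {z τ : ℂ}
    (hτ : τ.im ≤ 0) (v : n → ℂ) :
    z.im * ∑ q, ‖v q‖ ^ 2 ≤
      ‖star v ⬝ᵥ (H + τ • diagonal (fun q => (w q : ℂ)) - z • 1) *ᵥ v‖ := by
  refine le_trans ?_ (Complex.abs_im_le_norm _)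
  refine le_trans ?_ (neg_le_abs _)
  have h1 : (star v ⬝ᵥ H *ᵥ v).im = 0 := hH.im_star_dotProduct_mulVec_self v
  have h2 : star v ⬝ᵥ v = ((∑ q, ‖v q‖ ^ 2 : ℝ) : ℂ) := by
    simp [dotProduct, Complex.conj_mul']
  have h3 : star v ⬝ᵥ diagonal (fun q => (w q : ℂ)) *ᵥ v = ((∑ q, w q * ‖v q‖ ^ 2 : ℝ) : ℂ) := by
    simp only [dotProduct, mulVec_diagonal, Pi.star_apply, Complex.ofReal_sum]
    refine Finset.sum_congr rfl fun q _ => ?_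
    push_cast
    rw [← Complex.conj_mul']
    simp only [RCLike.star_def]
    ring
  have h4 : 0 ≤ ∑ q, w q * ‖v q‖ ^ 2 :=
    Finset.sum_nonneg fun q _ => mul_nonneg (hw q) (by positivity)
  rw [sub_mulVec, add_mulVec, smul_mulVec, smul_mulVec, one_mulVec, dotProduct_sub,
    dotProduct_add, dotProduct_smul, dotProduct_smul, h2, h3]
  simp only [smul_eq_mul, Complex.sub_im, Complex.add_im, h1, Complex.im_mul_ofReal]
  nlinarith

theorem det_sub_smul_one_ne_zero (hH : H.IsHermitian) (hw : ∀ q, 0 ≤ w q) {z τ : ℂ}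
    (hz : 0 < z.im) (hτ : τ.im ≤ 0) :
    (H + τ • diagonal (fun q => (w q : ℂ)) - z • 1).det ≠ 0 :=
  det_ne_zero_of_coercive hz (coercive_sub_smul_one hH hw hτ)

theorem differentiableAt_resolventEntry (hH : H.IsHermitian) (hw : ∀ q, 0 ≤ w q) {z τ : ℂ}
    (hz : 0 < z.im) (hτ : τ.im ≤ 0) : DifferentiableAt ℂ (resolventEntry H w j z) τ :=
  differentiableAt_inv_apply (A := fun τ => H + τ • diagonal (fun q => (w q : ℂ)) - z • 1)
    (fun i k => by
      simp only [Matrix.sub_apply, Matrix.add_apply, Matrix.smul_apply, smul_eq_mul]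
      fun_prop)
    (det_sub_smul_one_ne_zero hH hw hz hτ) j j

theorem continuous_resolventEntry (hH : H.IsHermitian) (hw : ∀ q, 0 ≤ w q) {ε : ℝ} (hε : 0 < ε) :
    Continuous fun p : ℝ × ℝ => resolventEntry H w j (p.1 + ε * Complex.I) p.2 := by
  have hA : Continuous fun p : ℝ × ℝ => H + (p.2 : ℂ) • diagonal (fun q => (w q : ℂ)) -
      ((p.1 : ℂ) + ε * Complex.I) • (1 : Matrix n n ℂ) := by fun_prop
  simp only [resolventEntry, inv_def, Ring.inverse_eq_inv', Matrix.smul_apply, smul_eq_mul]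
  refine (hA.matrix_det.inv₀ fun p => det_sub_smul_one_ne_zero hH hw (by simpa) (by simp)).mul
    (hA.matrix_adjugate.matrix_elem j j)

theorem exists_norm_resolventEntry_sub_le (hH : H.IsHermitian) (hw : ∀ q, 0 ≤ w q)
    (hj : 1 ≤ w j) {z : ℂ} (hz : 0 < z.im) :
    ∃ K : ℝ, ∀ τ : ℂ, τ.im ≤ 0 → τ ≠ 0 →
      ‖resolventEntry H w j z τ - ((w j)⁻¹ : ℝ) / (τ - Complex.I)‖ ≤ K / ‖τ‖ ^ 2 := by
  set B : Matrix n n ℂ := H - z • 1 with hB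
  set b : n → ℂ := fun k => B k j
  set C : ℝ := Real.sqrt ((∑ q, ‖b q‖ ^ 2) / z.im ^ 2)
  refine ⟨‖B j j‖ + (∑ k, ‖B j k‖ * C) + 1, fun τ hτ hτ0 => ?_⟩
  set A : Matrix n n ℂ := H + τ • diagonal (fun q => (w q : ℂ)) - z • 1 with hA
  have hdet : IsUnit A.det := isUnit_iff_ne_zero.2 (det_sub_smul_one_ne_zero hH hw hz hτ)
  have hAB : A = B + τ • diagonal (fun q => (w q : ℂ)) := by rw [hA, hB]; abel
  have hbd : ‖(B * A⁻¹ * B) j j‖ ≤ ∑ k, ‖B j k‖ * C := by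
    rw [Matrix.mul_assoc, mul_apply]
    refine (norm_sum_le _ _).trans (Finset.sum_le_sum fun k _ => ?_)
    rw [norm_mul]
    gcongr
    exact Real.le_sqrt_of_sq_le
      (norm_sq_inv_mulVec_le_of_coercive hz (coercive_sub_smul_one hH hw hτ) b k)
  set s : ℂ := τ * w j with hs
  have e1 : (A⁻¹ * B) j j + s * A⁻¹ j j = 1 := by
    have := congrFun (congrFun (Matrix.nonsing_inv_mul A hdet) j) j
    nth_rewrite 2 [hAB] at this
    rw [Matrix.mul_add, Matrix.mul_smul] at this
    simp only [Matrix.add_apply, Matrix.smul_apply, mul_diagonal, one_apply_eq, smul_eq_mul] at this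
    rw [← this, hs]
    ring
  have e2 : (B * A⁻¹ * B) j j + s * (A⁻¹ * B) j j = B j j := by
    have : (B + τ • diagonal (fun q => (w q : ℂ))) * A⁻¹ * B = B := by
      rw [← hAB, Matrix.mul_nonsing_inv A hdet, Matrix.one_mul]
    have := congrFun (congrFun this j) j
    rw [Matrix.add_mul, Matrix.add_mul, Matrix.smul_mul, Matrix.smul_mul,
      Matrix.mul_assoc (diagonal _)] at this
    simp only [Matrix.add_apply, Matrix.smul_apply, diagonal_mul, smul_eq_mul] at this
    rw [hs, mul_assoc τ]
    exact this
  have hwj : (w j : ℂ) ≠ 0 := by exact_mod_cast (by linarith : w j ≠ 0)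
  have hτI : τ - Complex.I ≠ 0 := by
    intro h
    have := congrArg Complex.im h
    simp at this
    linarith
  have hτn : ‖τ‖ ≤ ‖τ - Complex.I‖ := by
    rw [Complex.norm_def, Complex.norm_def]
    refine Real.sqrt_le_sqrt ?_
    simp only [Complex.normSq_apply, Complex.sub_re, Complex.sub_im, Complex.I_re, Complex.I_im]
    nlinarith
  have e3 : resolventEntry H w j z τ - ((w j)⁻¹ : ℝ) / (τ - Complex.I) =
      ((B * A⁻¹ * B) j j - B j j) / s ^ 2 - Complex.I / (τ * (τ - Complex.I) * w j) := by
    have : resolventEntry H w j z τ = A⁻¹ j j := rfl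
    rw [this]
    have hs0 : s ≠ 0 := mul_ne_zero hτ0 hwj
    have e4 : A⁻¹ j j = 1 / s + ((B * A⁻¹ * B) j j - B j j) / s ^ 2 := by
      field_simp
      linear_combination s * e1 - e2
    rw [e4, hs]
    push_cast
    field_simp
    ring
  have hnw : 1 ≤ ‖(w j : ℂ)‖ := by
    rw [Complex.norm_real]
    exact hj.trans (le_abs_self _)
  have hτp : 0 < ‖τ‖ := norm_pos_iff.2 hτ0
  have hsn : ‖τ‖ ≤ ‖s‖ := by
    rw [hs, norm_mul]
    exact le_mul_of_one_le_right hτp.le hnw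
  rw [e3]
  refine (norm_sub_le _ _).trans ?_
  rw [add_div _ 1]
  refine add_le_add ?_ ?_
  · rw [norm_div, norm_pow]
    have := norm_sub_le ((B * A⁻¹ * B) j j) (B j j)
    gcongr
    linarith
  · rw [norm_div, Complex.norm_I, norm_mul, norm_mul]
    gcongr
    calc ‖τ‖ ^ 2 = ‖τ‖ * ‖τ‖ * 1 := by ring
      _ ≤ _ := by gcongr

end

theorem lintegral_im_resolventEntry_le {n : Type*} [Fintype n] [DecidableEq n] {H : Matrix n n ℂ}
    {w : n → ℝ} {j : n} (hH : H.IsHermitian) (hw : ∀ q, 0 ≤ w q)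
    (hj : 1 ≤ w j) {z : ℂ} (hz : 0 < z.im) (hpos : ∀ t : ℝ, 0 ≤ (resolventEntry H w j z t).im) :
    ∫⁻ t : ℝ, ENNReal.ofReal (resolventEntry H w j z t).im ≤ ENNReal.ofReal Real.pi := by
  obtain ⟨K, hK⟩ := exists_norm_resolventEntry_sub_le hH hw hj hz
  have hj0 : 0 < w j := by linarith
  refine (lintegral_im_le_of_asymptotic (inv_nonneg.2 hj0.le)
    (fun τ hτ => differentiableAt_resolventEntry hH hw hz hτ) hK hpos).trans
    (ENNReal.ofReal_le_ofReal ?_)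
  exact mul_le_of_le_one_left Real.pi_pos.le (inv_le_one_of_one_le₀ hj)

theorem two_mul_arctan_le_integral {a b x δ ε : ℝ} (hx : x ∈ Set.Icc a b) (hε : 0 < ε) :
    2 * Real.arctan (δ / ε) ≤ ∫ y in (a - δ)..(b + δ), ε / ((x - y) ^ 2 + ε ^ 2) := by
  have hder : ∀ y ∈ Set.uIcc (a - δ) (b + δ),
      HasDerivAt (fun y => Real.arctan ((y - x) / ε)) (ε / ((x - y) ^ 2 + ε ^ 2)) y := by
    intro y _
    convert (((hasDerivAt_id' y).sub_const x).div_const ε).arctan using 1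
    have : 0 < (x - y) ^ 2 + ε ^ 2 := by positivity
    have : 0 < 1 + ((y - x) / ε) ^ 2 := by positivity
    field_simp
    ring
  have hcont : Continuous fun y => ε / ((x - y) ^ 2 + ε ^ 2) :=
    continuous_const.div (by fun_prop) fun y => by positivity
  rw [intervalIntegral.integral_eq_sub_of_hasDerivAt hder (hcont.intervalIntegrable _ _)]
  have h1 : Real.arctan (δ / ε) ≤ Real.arctan ((b + δ - x) / ε) := by
    gcongr
    linarith [hx.2]
  have h2 : Real.arctan ((a - δ - x) / ε) ≤ Real.arctan (-(δ / ε)) := by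
    rw [← neg_div]
    gcongr
    linarith [hx.1]
  rw [Real.arctan_neg] at h2
  linarith

theorem mul_diagonal_mul_star_apply {n : Type*} [Fintype n] [DecidableEq n] (U : Matrix n n ℂ)
    (d : n → ℂ) (j : n) :
    (U * diagonal d * star U) j j = ∑ k, ((‖U j k‖ ^ 2 : ℝ) : ℂ) * d k := by
  rw [mul_apply]
  refine Finset.sum_congr rfl fun k _ => ?_
  rw [mul_diagonal, star_apply]
  push_cast
  rw [← Complex.conj_mul', RCLike.star_def]
  ring

section
variable {n : Type*} [Fintype n] [DecidableEq n] {M : Matrix n n ℂ}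

theorem inv_sub_smul_one_apply (hM : M.IsHermitian) {z : ℂ} (hz : 0 < z.im) (j : n) :
    (M - z • 1)⁻¹ j j = ∑ k, ((‖(hM.eigenvectorUnitary : Matrix n n ℂ) j k‖ ^ 2 : ℝ) : ℂ) *
      (hM.eigenvalues k - z)⁻¹ := by
  rw [← mul_diagonal_mul_star_apply]
  set U : Matrix n n ℂ := (hM.eigenvectorUnitary : Matrix n n ℂ)
  have hUU : star U * U = 1 := Unitary.coe_star_mul_self hM.eigenvectorUnitary
  have hUU' : U * star U = 1 := Unitary.coe_mul_star_self hM.eigenvectorUnitary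
  have hne : ∀ k, (hM.eigenvalues k : ℂ) - z ≠ 0 := by
    intro k h
    have := congrArg Complex.im h
    simp at this
    linarith
  have hs : M - z • 1 = U * diagonal (fun k => (hM.eigenvalues k : ℂ) - z) * star U := by
    have h1 : M = U * diagonal (fun k => (hM.eigenvalues k : ℂ)) * star U := by
      have := hM.spectral_theorem
      rwa [Unitary.conjStarAlgAut_apply] at this
    have h2 : diagonal (fun k => (hM.eigenvalues k : ℂ) - z) =
        diagonal (fun k => (hM.eigenvalues k : ℂ)) - z • (1 : Matrix n n ℂ) := by
      rw [← diagonal_one, ← diagonal_smul, diagonal_sub]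
      simp
    rw [h2, Matrix.mul_sub, Matrix.sub_mul, ← h1, Matrix.mul_smul, Matrix.smul_mul,
      Matrix.mul_one, hUU']
  have : (M - z • 1)⁻¹ = U * diagonal (fun k => ((hM.eigenvalues k : ℂ) - z)⁻¹) * star U := by
    refine inv_eq_left_inv ?_
    calc _ = U * diagonal (fun k => ((hM.eigenvalues k : ℂ) - z)⁻¹) * (star U * U) *
          diagonal (fun k => (hM.eigenvalues k : ℂ) - z) * star U := by
          rw [hs]; simp only [Matrix.mul_assoc]
      _ = 1 := by
          rw [hUU, Matrix.mul_one, Matrix.mul_assoc U, diagonal_mul_diagonal]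
          simp only [inv_mul_cancel₀ (hne _)]
          rw [diagonal_one, Matrix.mul_one, hUU']
  rw [this]

theorem im_inv_sub_smul_one_apply (hM : M.IsHermitian) (E : ℝ) {ε : ℝ} (hε : 0 < ε) (j : n) :
    ((M - ((E : ℂ) + ε * Complex.I) • 1)⁻¹ j j).im =
      ∑ k, ‖(hM.eigenvectorUnitary : Matrix n n ℂ) j k‖ ^ 2 *
        (ε / ((hM.eigenvalues k - E) ^ 2 + ε ^ 2)) := by
  rw [inv_sub_smul_one_apply hM (by simpa), Complex.im_sum]
  refine Finset.sum_congr rfl fun k _ => ?_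
  rw [Complex.im_ofReal_mul, Complex.inv_im, Complex.normSq_apply]
  congr 1
  simp
  ring_nf

theorem specProj_apply_re (hM : M.IsHermitian) (I : Set ℝ) (j : n) :
    (specProj hM I j j).re = ∑ k, ‖(hM.eigenvectorUnitary : Matrix n n ℂ) j k‖ ^ 2 *
      I.indicator (fun _ => (1 : ℝ)) (hM.eigenvalues k) := by
  rw [specProj, mul_diagonal_mul_star_apply, Complex.re_sum]
  refine Finset.sum_congr rfl fun k _ => ?_
  rw [Complex.re_ofReal_mul]
  by_cases h : hM.eigenvalues k ∈ I <;> simp [h]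

theorem specProj_apply_re_nonneg (hM : M.IsHermitian) (I : Set ℝ) (j : n) :
    0 ≤ (specProj hM I j j).re := by
  rw [specProj_apply_re]
  exact Finset.sum_nonneg fun k _ => mul_nonneg (by positivity)
    (Set.indicator_nonneg (fun _ _ => zero_le_one) _)

theorem arctan_mul_specProj_le (hM : M.IsHermitian) (j : n) {a b δ ε : ℝ} (hab : a ≤ b)
    (hδ : 0 < δ) (hε : 0 < ε) :
    2 * Real.arctan (δ / ε) * (specProj hM (Set.Icc a b) j j).re ≤
      ∫ E in (a - δ)..(b + δ), ((M - ((E : ℂ) + ε * Complex.I) • 1)⁻¹ j j).im := by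
  simp_rw [im_inv_sub_smul_one_apply hM _ hε]
  rw [specProj_apply_re, intervalIntegral.integral_finsetSum, Finset.mul_sum]
  · refine Finset.sum_le_sum fun k _ => ?_
    rw [intervalIntegral.integral_const_mul, mul_left_comm]
    gcongr
    by_cases h : hM.eigenvalues k ∈ Set.Icc a b
    · rw [Set.indicator_of_mem h, mul_one]
      exact two_mul_arctan_le_integral h hε
    · rw [Set.indicator_of_notMem h, mul_zero]
      exact intervalIntegral.integral_nonneg (by linarith) fun y _ => by positivity
  · intro k _
    refine Continuous.intervalIntegrable ?_ _ _
    exact continuous_const.mul (continuous_const.div (by fun_prop) fun y => by positivity)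

theorem star_dotProduct_chi_mulVec (P : Matrix n n ℂ) (j : n) (φ : n → ℂ) :
    (star φ ⬝ᵥ (chi j * P * chi j) *ᵥ φ).re = ‖φ j‖ ^ 2 * (P j j).re := by
  have h : ∀ k, ((chi j * P * chi j) *ᵥ φ) k = if k = j then P j j * φ j else 0 := by
    intro k
    simp only [chi, mulVec, dotProduct, mul_diagonal, diagonal_mul]
    by_cases hk : k = j <;> simp [hk]
  simp only [dotProduct, h]
  simp only [mul_ite, mul_zero, Finset.sum_ite_eq', Finset.mem_univ, if_true, Pi.star_apply]
  rw [mul_left_comm, RCLike.star_def, Complex.conj_mul', mul_comm, ← Complex.ofReal_pow,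
    Complex.re_ofReal_mul]

end

theorem lintegral_specProj_le {n : Type*} [Fintype n] [DecidableEq n] {H : Matrix n n ℂ}
    {w : n → ℝ} {j : n} (hH : H.IsHermitian) (hw : ∀ q, 0 ≤ w q) (hj : 1 ≤ w j)
    (hherm : ∀ t : ℝ, (H + (t : ℂ) • diagonal fun q => (w q : ℂ)).IsHermitian) {a b δ ε : ℝ}
    (hab : a ≤ b) (hδ : 0 < δ) (hε : 0 < ε) :
    ENNReal.ofReal (2 * Real.arctan (δ / ε)) *
      ∫⁻ t : ℝ, ENNReal.ofReal (specProj (hherm t) (Set.Icc a b) j j).re ≤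
      ENNReal.ofReal (Real.pi * (b - a + 2 * δ)) := by
  have hcont := continuous_resolventEntry (j := j) hH hw hε
  have him : Continuous fun p : ℝ × ℝ => (resolventEntry H w j (p.1 + ε * Complex.I) p.2).im :=
    Complex.continuous_im.comp hcont
  have hpos : ∀ E t : ℝ, 0 ≤ (resolventEntry H w j (E + ε * Complex.I) t).im := by
    intro E t
    have := im_inv_sub_smul_one_apply (hherm t) E hε j
    rw [resolventEntry, this]
    exact Finset.sum_nonneg fun k _ => by positivity
  have hmeas : Measurable (Function.uncurry fun t E : ℝ =>
      ENNReal.ofReal (resolventEntry H w j (E + ε * Complex.I) t).im) :=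
    (him.measurable.comp measurable_swap).ennreal_ofReal
  have harctan : 0 ≤ 2 * Real.arctan (δ / ε) := by
    have := Real.arctan_nonneg.2 (div_pos hδ hε).le
    positivity
  rw [← lintegral_const_mul' _ _ ENNReal.ofReal_ne_top]
  calc _ ≤ ∫⁻ t : ℝ, ∫⁻ E in Set.Ioc (a - δ) (b + δ),
        ENNReal.ofReal (resolventEntry H w j (E + ε * Complex.I) t).im := by
        refine lintegral_mono fun t => ?_
        have hcE : Continuous fun E : ℝ => (resolventEntry H w j (E + ε * Complex.I) t).im :=
          him.comp (g := fun p : ℝ × ℝ => (resolventEntry H w j (p.1 + ε * Complex.I) p.2).im)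
            (f := fun E : ℝ => (E, t)) (by fun_prop)
        have hE := ofReal_integral_eq_lintegral_ofReal
          (hcE.intervalIntegrable (μ := volume) (a - δ) (b + δ)).1
          (Filter.Eventually.of_forall fun E => hpos E t)
        rw [← ENNReal.ofReal_mul harctan, ← hE, ← intervalIntegral.integral_of_le (by linarith)]
        exact ENNReal.ofReal_le_ofReal (arctan_mul_specProj_le (hherm t) j hab hδ hε)
    _ = ∫⁻ E in Set.Ioc (a - δ) (b + δ), ∫⁻ t : ℝ,
        ENNReal.ofReal (resolventEntry H w j (E + ε * Complex.I) t).im :=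
        lintegral_lintegral_swap hmeas.aemeasurable
    _ ≤ ∫⁻ _ in Set.Ioc (a - δ) (b + δ), ENNReal.ofReal Real.pi :=
        lintegral_mono fun E => lintegral_im_resolventEntry_le hH hw hj (by simpa) (hpos E)
    _ = ENNReal.ofReal (Real.pi * (b - a + 2 * δ)) := by
        rw [setLIntegral_const, Real.volume_Ioc, ← ENNReal.ofReal_mul Real.pi_pos.le]
        congr 2
        ring

/-- **Spectral averaging (Combes–Hislop), discrete finite-dimensional version,
Proposition 1(b) of the paper**: if `H` is Hermitian on `ℓ²(Q)`, `w ≥ 1_{{j}}`,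
`H_t = H + t·M_w`, and `P_t(I)` is the spectral projection of `H_t` onto `I = [E₁,E₂]`,
then for every nonnegative bounded compactly supported measurable `g` and every
normalized `φ ∈ ℓ²(Q)`,
`∫ g(t) ⟨φ, χ_j P_t(I) χ_j φ⟩ dt ≤ (E₂-E₁) ‖g‖_∞`,
with `‖g‖_∞` the essential supremum of `g`. -/
theorem spectral_averaging
    (Q : Type*) [Fintype Q] [DecidableEq Q] (j : Q)
    (H : Matrix Q Q ℂ) (hH : H.IsHermitian)
    (w : Q → ℝ) (hw : ∀ x, w x ≥ if x = j then 1 else 0)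
    (hherm : ∀ t : ℝ, (H + (t : ℂ) • Matrix.diagonal fun q => (w q : ℂ)).IsHermitian)
    (E₁ E₂ : ℝ) (hE : E₁ ≤ E₂)
    (g : ℝ → ℝ) (hg0 : ∀ t, 0 ≤ g t) (hgm : Measurable g)
    (hgb : ∃ C, ∀ t, g t ≤ C) (hgc : HasCompactSupport g)
    (φ : Q → ℂ) (hφ : ∑ q, ‖φ q‖ ^ 2 = 1) :
    ∫ t : ℝ, g t *
        (star φ ⬝ᵥ (chi j * specProj (hherm t) (Set.Icc E₁ E₂) * chi j) *ᵥ φ).re ≤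
      (E₂ - E₁) * essSup g volume := by
  have hw0 : ∀ q, 0 ≤ w q := fun q => le_trans (by split_ifs <;> norm_num) (hw q)
  have hj : 1 ≤ w j := by simpa using hw j
  obtain ⟨C, hC⟩ := hgb
  have hle : ∀ᵐ t, g t ≤ essSup g volume :=
    ae_le_essSup ⟨C, Filter.eventually_map.2 (Filter.Eventually.of_forall hC)⟩
  have hM : 0 ≤ essSup g volume := by
    obtain ⟨t, ht⟩ := hle.exists
    exact (hg0 t).trans ht
  simp only [star_dotProduct_chi_mulVec]
  by_cases hint : Integrable fun t : ℝ =>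
      g t * (‖φ j‖ ^ 2 * (specProj (hherm t) (Set.Icc E₁ E₂) j j).re)
  swap
  · rw [integral_undef hint]
    exact mul_nonneg (by linarith) hM
  have hφj : ‖φ j‖ ^ 2 ≤ 1 := hφ ▸ Finset.single_le_sum (f := fun q => ‖φ q‖ ^ 2)
    (fun i _ => by positivity) (Finset.mem_univ j)
  have hp : ∀ t, 0 ≤ (specProj (hherm t) (Set.Icc E₁ E₂) j j).re := fun t =>
    specProj_apply_re_nonneg (hherm t) _ j
  set J := ∫ t : ℝ, g t * (‖φ j‖ ^ 2 * (specProj (hherm t) (Set.Icc E₁ E₂) j j).re) with hJ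
  have hJle : ENNReal.ofReal J ≤ ENNReal.ofReal (essSup g volume) *
      ∫⁻ t : ℝ, ENNReal.ofReal (specProj (hherm t) (Set.Icc E₁ E₂) j j).re := by
    rw [hJ, ofReal_integral_eq_lintegral_ofReal hint (Filter.Eventually.of_forall fun t =>
      mul_nonneg (hg0 t) (mul_nonneg (by positivity) (hp t))),
      ← lintegral_const_mul' _ _ ENNReal.ofReal_ne_top]
    refine lintegral_mono_ae (hle.mono fun t ht => ?_)
    rw [← ENNReal.ofReal_mul hM]
    refine ENNReal.ofReal_le_ofReal (mul_le_mul ht ?_ (mul_nonneg (by positivity) (hp t)) hM)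
    exact mul_le_of_le_one_left (hp t) hφj
  have hbound : ∀ δ : ℝ, 0 < δ →
      2 * Real.arctan δ⁻¹ * J ≤ Real.pi * (E₂ - E₁ + 2 * δ) * essSup g volume := by
    intro δ hδ
    have harctan : 0 ≤ 2 * Real.arctan δ⁻¹ := by
      have := Real.arctan_nonneg.2 (inv_pos.2 hδ).le
      positivity
    have h := lintegral_specProj_le (j := j) hH hw0 hj hherm hE hδ (sq_pos_of_pos hδ)
    rw [show δ / δ ^ 2 = δ⁻¹ by field_simp] at h
    have hnn : 0 ≤ Real.pi * (E₂ - E₁ + 2 * δ) := mul_nonneg Real.pi_pos.le (by linarith)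
    rw [← ENNReal.ofReal_le_ofReal_iff (mul_nonneg hnn hM), ENNReal.ofReal_mul harctan,
      mul_comm _ (essSup g volume), ENNReal.ofReal_mul hM]
    calc _ ≤ _ := mul_le_mul_right hJle _
      _ = _ := mul_left_comm _ _ _
      _ ≤ _ := mul_le_mul_right h _
  have hlim1 : Filter.Tendsto (fun δ : ℝ => 2 * Real.arctan δ⁻¹ * J) (nhdsWithin 0 (Set.Ioi 0))
      (nhds (2 * (Real.pi / 2) * J)) :=
    (((tendsto_nhds_of_tendsto_nhdsWithin Real.tendsto_arctan_atTop).comp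
      tendsto_inv_nhdsGT_zero).const_mul 2).mul_const J
  have hlim2 : Filter.Tendsto (fun δ : ℝ => Real.pi * (E₂ - E₁ + 2 * δ) * essSup g volume)
      (nhdsWithin 0 (Set.Ioi 0)) (nhds (Real.pi * (E₂ - E₁ + 2 * 0) * essSup g volume)) :=
    (Continuous.tendsto (by fun_prop) 0).mono_left nhdsWithin_le_nhds
  have h := le_of_tendsto_of_tendsto hlim1 hlim2
    (Filter.eventually_of_mem self_mem_nhdsWithin hbound)
  refine le_of_mul_le_mul_left ?_ Real.pi_pos
  linarith

end
end
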